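/- arXiv:1705.01724 — 4 statements merged into one kernel-verified Lean document; each statement's English description precedes it below -/
import Mathlib

section
/- Let U ⊂ ℝ^m be compact with the Whitney property with constant C ≥ 1. Let u : [a,b] → U have bounded variation V := Var_{[a,b]}(u) and let ū₁ ∈ U. Then there exist S̃ > 0 and a 1-Lipschitz map (φ₀,φ) : [0,S̃] → [a,b] × U such that: φ₀ is nondecreasing; φ₀'(s) + |φ'(s)| = 1 for a.e. s ∈ [0,S̃]; (φ₀,φ)(0) = (a,u(a)); for every t ∈ [a,b] there exists s ∈ [0,S̃] with (φ₀,φ)(s) = (t,u(t)); (φ₀,φ)(S̃) = (b,u(b)); there exists S ≤ S̃ with (φ₀,φ)(S) = (b,ū₁); and moreover (b−a) + V + |u(b)−ū₁| ≤ S ≤ S̃ ≤ (b−a) + 2C(V + |u(b)−ū₁|). -/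
open MeasureTheory Set Filter Topology
open scoped ENNReal

noncomputable section

/-- `f` is absolutely continuous on `[a,b]`: it has an integrable density whose
integral recovers `f`. -/
def ACOn {E : Type*} [NormedAddCommGroup E] [NormedSpace ℝ E] (f : ℝ → E) (a b : ℝ) : Prop :=
  ∃ f' : ℝ → E, IntervalIntegrable f' volume a b ∧
    ∀ t ∈ Icc a b, f t = f a + ∫ s in a..t, f' s

/-- The Whitney property with constant `C`: any two points of `U` can be joined by an
absolutely continuous path in `U` of variation at most `C` times their distance. -/
def WhitneyWith {m : ℕ} (U : Set (EuclideanSpace ℝ (Fin m))) (C : ℝ) : Prop :=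
  ∀ u1 ∈ U, ∀ u2 ∈ U, ∃ γ : ℝ → EuclideanSpace ℝ (Fin m),
    (∀ t ∈ Icc (0:ℝ) 1, γ t ∈ U) ∧ γ 0 = u1 ∧ γ 1 = u2 ∧ ACOn γ 0 1 ∧
    eVariationOn γ (Icc (0:ℝ) 1) ≤ ENNReal.ofReal (C * ‖u1 - u2‖)

/-- Variation bound from a control function. -/
lemma var_le_of_control {F : Type*} [PseudoMetricSpace F] {f : ℝ → F} {g : ℝ → ℝ} {p q : ℝ}
    (h : ∀ x ∈ Icc p q, ∀ y ∈ Icc p q, x ≤ y → dist (f x) (f y) ≤ g y - g x) :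
    eVariationOn f (Icc p q) ≤ ENNReal.ofReal (g q - g p) := by
  refine iSup_le ?_
  rintro ⟨n, v, hv, hvm⟩
  dsimp only
  have gm : ∀ x ∈ Icc p q, ∀ y ∈ Icc p q, x ≤ y → g x ≤ g y := fun x hx y hy hxy => by
    have := h x hx y hy hxy
    have := dist_nonneg (x := f x) (y := f y)
    linarith
  have hpq : p ≤ q := (hvm 0).1.trans (hvm 0).2
  calc ∑ i ∈ Finset.range n, edist (f (v (i + 1))) (f (v i))
      ≤ ∑ i ∈ Finset.range n, ENNReal.ofReal (g (v (i+1)) - g (v i)) := by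
        refine Finset.sum_le_sum fun i _ => ?_
        rw [edist_comm, edist_dist]
        exact ENNReal.ofReal_le_ofReal (h _ (hvm _) _ (hvm _) (hv (Nat.le_succ i)))
    _ = ENNReal.ofReal (∑ i ∈ Finset.range n, (g (v (i+1)) - g (v i))) := by
        rw [ENNReal.ofReal_sum_of_nonneg]
        intro i _
        exact sub_nonneg.2 (gm _ (hvm _) _ (hvm _) (hv (Nat.le_succ i)))
    _ ≤ ENNReal.ofReal (g q - g p) := by
        rw [Finset.sum_range_sub (fun i => g (v i))]
        refine ENNReal.ofReal_le_ofReal (sub_le_sub ?_ ?_)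
        · exact gm _ (hvm _) _ (right_mem_Icc.2 hpq) (hvm n).2
        · exact gm _ (left_mem_Icc.2 hpq) _ (hvm _) (hvm 0).1

/-- Arc length reparametrization. -/
lemma arclength {F : Type*} [MetricSpace F] {f : ℝ → F} {g : ℝ → ℝ} {p q : ℝ} (hpq : p ≤ q)
    (hg : ContinuousOn g (Icc p q))
    (h : ∀ x ∈ Icc p q, ∀ y ∈ Icc p q, x ≤ y → dist (f x) (f y) ≤ g y - g x) :
    ∃ (σ : ℝ → ℝ) (ψ : ℝ → F) (l : ℝ), 0 ≤ l ∧ l ≤ g q - g p ∧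
      ENNReal.ofReal l = eVariationOn f (Icc p q) ∧ MonotoneOn σ (Icc p q) ∧ σ p = 0 ∧ σ q = l ∧
      (∀ t ∈ Icc p q, σ t ∈ Icc 0 l ∧ ψ (σ t) = f t) ∧
      (∀ s, ∃ t ∈ Icc p q, ψ s = f t ∧ σ t = max 0 (min s l)) ∧
      LipschitzWith 1 ψ ∧ ENNReal.ofReal l ≤ eVariationOn ψ (Icc 0 l) := by
  have hv := var_le_of_control h
  have hBV : BoundedVariationOn f (Icc p q) := (hv.trans_lt ENNReal.ofReal_lt_top).ne
  have hLB := hBV.locallyBoundedVariationOn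
  have hp : p ∈ Icc p q := left_mem_Icc.2 hpq
  have hq : q ∈ Icc p q := right_mem_Icc.2 hpq
  set σ := variationOnFromTo f (Icc p q) p with hσ
  have hmono : MonotoneOn σ (Icc p q) := variationOnFromTo.monotoneOn hLB hp
  have hσp : σ p = 0 := variationOnFromTo.self f _ p
  have hσq : σ q = (eVariationOn f (Icc p q)).toReal := by
    rw [hσ, variationOnFromTo.eq_of_le f _ hpq, inter_self]
  have hl : 0 ≤ σ q := by rw [hσq]; exact ENNReal.toReal_nonneg
  have hgpq : 0 ≤ g q - g p := dist_nonneg.trans (h p hp q hq hpq)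
  have hmem : ∀ t ∈ Icc p q, σ t ∈ Icc 0 (σ q) := fun t ht =>
    ⟨hσp ▸ hmono hp ht ht.1, hmono ht hq ht.2⟩
  -- increments are controlled
  have hinc : ∀ x ∈ Icc p q, ∀ y ∈ Icc p q, x ≤ y → σ y - σ x ≤ g y - g x := by
    intro x hx y hy hxy
    rw [hσ, variationOnFromTo.sub_right hLB hp hy hx, variationOnFromTo.eq_of_le f _ hxy]
    have h0 : 0 ≤ g y - g x := dist_nonneg.trans (h x hx y hy hxy)
    refine ENNReal.toReal_le_of_le_ofReal h0 ?_
    refine (eVariationOn.mono f inter_subset_right).trans (var_le_of_control ?_)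
    intro x' hx' y' hy' h'
    exact h x' ⟨hx.1.trans hx'.1, hx'.2.trans hy.2⟩ y' ⟨hx.1.trans hy'.1, hy'.2.trans hy.2⟩ h'
  have hcont : ContinuousOn σ (Icc p q) := by
    rw [Metric.continuousOn_iff] at hg ⊢
    intro x hx ε hε
    obtain ⟨δ, hδ, H⟩ := hg x hx ε hε
    refine ⟨δ, hδ, fun y hy hyx => (lt_of_le_of_lt ?_ (H y hy hyx))⟩
    rw [Real.dist_eq, Real.dist_eq]
    rcases le_total x y with hxy | hxy
    · have h1 := hinc x hx y hy hxy
      have h2 := hmono hx hy hxy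
      rw [abs_of_nonneg (by linarith), abs_of_nonneg (by linarith)]; exact h1
    · have h1 := hinc y hy x hx hxy
      have h2 := hmono hy hx hxy
      rw [abs_of_nonpos (by linarith), abs_of_nonpos (by linarith)]; linarith
  have himg : σ '' Icc p q = Icc 0 (σ q) := by
    apply Subset.antisymm
    · rintro _ ⟨t, ht, rfl⟩; exact hmem t ht
    · have := intermediate_value_Icc hpq hcont
      rwa [hσp] at this
  have hus := has_unit_speed_naturalParameterization f hLB hp
  rw [← hσ, himg] at hus
  set N := naturalParameterization f (Icc p q) p with hN
  have hNσ : ∀ t ∈ Icc p q, N (σ t) = f t := fun t ht =>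
    edist_eq_zero.1 (edist_naturalParameterization_eq_zero hLB hp ht)
  have hcl : ∀ s, max 0 (min s (σ q)) ∈ Icc 0 (σ q) := fun s =>
    ⟨le_max_left _ _, max_le hl (min_le_right _ _)⟩
  have hid : ∀ s ∈ Icc 0 (σ q), max 0 (min s (σ q)) = s := fun s hs => by
    rw [min_eq_left hs.2, max_eq_right hs.1]
  have hNL : ∀ s ∈ Icc 0 (σ q), ∀ s' ∈ Icc 0 (σ q), s ≤ s' → dist (N s) (N s') ≤ s' - s := by
    intro s hs s' hs' hss
    have h1 := hus hs hs'
    have h2 := eVariationOn.edist_le N (s := Icc 0 (σ q) ∩ Icc s s') (x := s) (y := s')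
      ⟨hs, le_rfl, hss⟩ ⟨hs', hss, le_rfl⟩
    rw [h1, edist_dist] at h2
    simp only [NNReal.coe_one, one_mul] at h2
    exact (ENNReal.ofReal_le_ofReal_iff (sub_nonneg.2 hss)).1 h2
  refine ⟨σ, fun s => N (max 0 (min s (σ q))), σ q, hl, ?_, ?_, hmono, hσp, rfl, ?_, ?_, ?_, ?_⟩
  · have := hinc p hp q hq hpq
    rw [hσp] at this; linarith
  · rw [hσq, ENNReal.ofReal_toReal hBV]
  · intro t ht
    refine ⟨hmem t ht, ?_⟩
    simp only [hid _ (hmem t ht)]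
    exact hNσ t ht
  · intro s
    have := hcl s
    rw [← himg] at this
    obtain ⟨t, ht, hts⟩ := this
    exact ⟨t, ht, by simp only [← hts]; exact hNσ t ht, hts⟩
  · refine LipschitzWith.of_dist_le_mul fun s s' => ?_
    simp only [NNReal.coe_one, one_mul]
    wlog hss : s ≤ s' generalizing s s'
    · rw [dist_comm, dist_comm s]; exact this s' s (le_of_not_ge hss)
    refine (hNL _ (hcl s) _ (hcl s') (by gcongr)).trans ?_
    rw [Real.dist_eq, abs_sub_comm, abs_of_nonneg (by linarith)]
    rcases max_cases 0 (min s (σ q)) with h1 | h1 <;> rcases max_cases 0 (min s' (σ q)) with h2 | h2 <;>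
    rcases min_cases s (σ q) with h3 | h3 <;> rcases min_cases s' (σ q) with h4 | h4 <;> linarith
  · have h0 := hus (left_mem_Icc.2 hl) (right_mem_Icc.2 hl)
    simp only [NNReal.coe_one, one_mul, inter_self, sub_zero] at h0
    rw [← h0]
    refine le_of_eq (eVariationOn.congr ?_)
    intro s hs
    simp only [hid s hs]

lemma ftc_lipschitz {F : Type*} [NormedAddCommGroup F] [NormedSpace ℝ F] [FiniteDimensional ℝ F]
    {ψ : ℝ → F} (hψ : LipschitzWith 1 ψ) (x y : ℝ) :
    IntervalIntegrable (deriv ψ) volume x y ∧ ∫ s in x..y, deriv ψ s = ψ y - ψ x := by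
  have : CompleteSpace F := FiniteDimensional.complete ℝ F
  have hint : IntervalIntegrable (deriv ψ) volume x y := by
    refine (intervalIntegrable_const (c := (1:ℝ))).mono_fun
      (stronglyMeasurable_deriv ψ).aestronglyMeasurable ?_
    refine ae_of_all _ fun s => ?_
    simpa using norm_deriv_le_of_lipschitz (x₀ := s) hψ
  refine ⟨hint, ?_⟩
  refine (SeparatingDual.eq_iff_forall_dual_eq (R := ℝ)).2 fun L => ?_
  rw [← ContinuousLinearMap.intervalIntegral_comp_comm L hint, map_sub]
  have hL : LipschitzWith (‖L‖₊ * 1) (fun s => L (ψ s)) := L.lipschitz.comp hψ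
  have hac := (hL.lipschitzOnWith (s := uIcc x y)).absolutelyContinuousOnInterval
  rw [← hac.integral_deriv_eq_sub]
  refine intervalIntegral.integral_congr_ae ?_
  filter_upwards [hψ.ae_differentiableAt_real] with s hs _
  exact ((L.hasFDerivAt.comp_hasDerivAt s hs.hasDerivAt).deriv).symm

lemma unit_speed_deriv {F : Type*} [NormedAddCommGroup F] [NormedSpace ℝ F]
    [FiniteDimensional ℝ F] {ψ : ℝ → F} (hψ : LipschitzWith 1 ψ) {l : ℝ} (hl : 0 ≤ l)
    (hvar : ENNReal.ofReal l ≤ eVariationOn ψ (Icc 0 l)) :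
    ∀ᵐ s ∂volume, s ∈ Ioo (0:ℝ) l → ‖deriv ψ s‖ = 1 := by
  have hn : ∀ x y, IntervalIntegrable (fun s => ‖deriv ψ s‖) volume x y := fun x y =>
    (ftc_lipschitz hψ x y).1.norm
  have hle1 : ∀ s, ‖deriv ψ s‖ ≤ 1 := fun s => by
    simpa using norm_deriv_le_of_lipschitz (x₀ := s) hψ
  have hb := var_le_of_control (f := ψ) (g := fun t => ∫ s in (0:ℝ)..t, ‖deriv ψ s‖)
    (p := 0) (q := l) (by
      intro x _ y _ hxy
      rw [intervalIntegral.integral_interval_sub_left (hn _ _) (hn _ _), dist_comm, dist_eq_norm,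
        ← (ftc_lipschitz hψ x y).2]
      exact intervalIntegral.norm_integral_le_integral_norm hxy)
  have h1 := hvar.trans hb
  simp only [intervalIntegral.integral_same, sub_zero] at h1
  rw [ENNReal.ofReal_le_ofReal_iff (intervalIntegral.integral_nonneg hl fun _ _ => norm_nonneg _)]
    at h1
  have h2 : ∫ s in (0:ℝ)..l, (1 - ‖deriv ψ s‖) = 0 := by
    apply le_antisymm
    · rw [intervalIntegral.integral_sub (by simp) (hn _ _)]
      simp; linarith
    · exact intervalIntegral.integral_nonneg hl fun s _ => sub_nonneg.2 (hle1 s)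
  rw [intervalIntegral.integral_eq_zero_iff_of_le_of_nonneg_ae hl] at h2
  · rw [Filter.EventuallyEq, ae_restrict_iff' measurableSet_Ioc] at h2
    filter_upwards [h2] with s hs hs'
    have := hs ⟨hs'.1, hs'.2.le⟩
    simp at this
    linarith
  · exact ae_of_all _ fun s => sub_nonneg.2 (hle1 s)
  · exact intervalIntegrable_const.sub (hn _ _)

/-- Time-space with the `L¹` norm. -/
abbrev TS (E : Type*) := WithLp 1 (ℝ × E)

/-- A point of time-space. -/
abbrev pt {E : Type*} (t : ℝ) (v : E) : TS E := WithLp.toLp 1 (t, v)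

/-- The box `[a,b] × U`. -/
def box {E : Type*} (a b : ℝ) (U : Set E) : Set (TS E) := {w | w.fst ∈ Icc a b ∧ w.snd ∈ U}

/-- A globally defined 1-Lipschitz path in `X`, with nondecreasing time, from `P` to `Q`. -/
structure IsPath {E : Type*} [NormedAddCommGroup E] (X : Set (TS E)) (P Q : TS E) (L : ℝ)
    (ψ : ℝ → TS E) : Prop where
  nonneg : 0 ≤ L
  lip : LipschitzWith 1 ψ
  mono : Monotone (fun s => (ψ s).fst)
  mem : ∀ s, ψ s ∈ X
  left : ∀ s ≤ 0, ψ s = P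
  right : ∀ s, L ≤ s → ψ s = Q

lemma lip_one_of_le {F : Type*} [PseudoMetricSpace F] {ψ : ℝ → F}
    (h : ∀ s s', s ≤ s' → dist (ψ s) (ψ s') ≤ s' - s) : LipschitzWith 1 ψ := by
  refine LipschitzWith.of_dist_le_mul fun s s' => ?_
  simp only [NNReal.coe_one, one_mul]
  wlog hss : s ≤ s' generalizing s s'
  · rw [dist_comm, dist_comm s]; exact this s' s (le_of_not_ge hss)
  rw [Real.dist_eq, abs_sub_comm, abs_of_nonneg (by linarith)]
  exact h s s' hss

lemma le_of_lip_one {F : Type*} [PseudoMetricSpace F] {ψ : ℝ → F}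
    (h : LipschitzWith 1 ψ) {s s' : ℝ} (hs : s ≤ s') : dist (ψ s) (ψ s') ≤ s' - s := by
  have := h.dist_le_mul s s'
  rw [Real.dist_eq, abs_sub_comm, abs_of_nonneg (by linarith)] at this
  simpa using this

namespace IsPath

variable {E : Type*} [NormedAddCommGroup E] {X : Set (TS E)} {P Q R : TS E} {L L' : ℝ}
  {ψ ψ' : ℝ → TS E}

lemma enlarge (h : IsPath X P Q L ψ) (hL : L ≤ L') : IsPath X P Q L' ψ :=
  ⟨h.nonneg.trans hL, h.lip, h.mono, h.mem, h.left, fun s hs => h.right s (hL.trans hs)⟩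

lemma concat (h : IsPath X P Q L ψ) (h' : IsPath X Q R L' ψ') :
    IsPath X P R (L + L') (fun s => if s ≤ L then ψ s else ψ' (s - L)) where
  nonneg := add_nonneg h.nonneg h'.nonneg
  lip := by
    refine lip_one_of_le fun s s' hs => ?_
    by_cases h1 : s ≤ L <;> by_cases h2 : s' ≤ L
    · simp only [h1, h2, if_true]; exact le_of_lip_one h.lip hs
    · simp only [h1, h2, if_true, if_false]
      have e1 := le_of_lip_one h.lip h1
      have e2 := le_of_lip_one h'.lip (s := 0) (s' := s' - L) (by linarith)
      rw [h.right L le_rfl] at e1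
      rw [h'.left 0 le_rfl] at e2
      have := dist_triangle (ψ s) Q (ψ' (s' - L))
      linarith
    · exact absurd (hs.trans h2) h1
    · simp only [h1, h2, if_false]
      have := le_of_lip_one h'.lip (s := s - L) (s' := s' - L) (by linarith)
      linarith
  mono := by
    intro s s' hs
    by_cases h1 : s ≤ L <;> by_cases h2 : s' ≤ L
    · simp only [h1, h2, if_true]; exact h.mono hs
    · simp only [h1, h2, if_true, if_false]
      have e1 := h.mono h1
      have e2 := h'.mono (a := 0) (b := s' - L) (by linarith)
      simp only [h.right L le_rfl, h'.left 0 le_rfl] at e1 e2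
      exact e1.trans e2
    · exact absurd (hs.trans h2) h1
    · simp only [h1, h2, if_false]
      exact h'.mono (by linarith)
  mem := fun s => by
    by_cases h1 : s ≤ L
    · simp only [h1, if_true]; exact h.mem s
    · simp only [h1, if_false]; exact h'.mem _
  left := fun s hs => by
    simp only [hs.trans h.nonneg, if_true]; exact h.left s hs
  right := fun s hs => by
    by_cases h1 : s ≤ L
    · have h2 := h'.nonneg
      have h3 : s = L := by linarith
      have h4 : L' = 0 := by linarith
      simp only [h1, if_true]
      rw [h.right s h3.ge, ← h'.left 0 le_rfl, h'.right 0 h4.le]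
    · simp only [h1, if_false]; exact h'.right _ (by linarith)

end IsPath

lemma path_time {E : Type*} [NormedAddCommGroup E] {U : Set E} {a b : ℝ} {v : E} (hv : v ∈ U)
    {t t' : ℝ} (ht : t ∈ Icc a b) (ht' : t' ∈ Icc a b) (h : t ≤ t') :
    ∃ ψ, IsPath (box a b U) (pt t v) (pt t' v) (t' - t) ψ := by
  refine ⟨fun s => pt (max t (min (t + s) t')) v, by linarith, ?_, ?_, ?_, ?_, ?_⟩
  · refine lip_one_of_le fun s s' hs => ?_
    rw [WithLp.prod_dist_eq_of_L1]
    simp only [WithLp.toLp_fst, WithLp.toLp_snd, dist_self, add_zero, Real.dist_eq]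
    rw [abs_le]
    rcases max_cases t (min (t + s) t') with h1 | h1 <;>
    rcases max_cases t (min (t + s') t') with h2 | h2 <;>
    rcases min_cases (t + s) t' with h3 | h3 <;> rcases min_cases (t + s') t' with h4 | h4 <;>
    constructor <;> linarith
  · intro s s' hs
    simp only [WithLp.toLp_fst]
    gcongr
  · intro s
    exact ⟨⟨ht.1.trans (le_max_left _ _), (max_le h (min_le_right _ _)).trans ht'.2⟩, hv⟩
  · intro s hs
    have : max t (min (t + s) t') = t := max_eq_left ((min_le_left _ _).trans (by linarith))
    simp only [this]
  · intro s hs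
    have : max t (min (t + s) t') = t' := by rw [min_eq_right (by linarith), max_eq_right h]
    simp only [this]

lemma path_whitney {m : ℕ} {U : Set (EuclideanSpace ℝ (Fin m))} {C : ℝ} (hW : WhitneyWith U C)
    (hC : 1 ≤ C) {a b t : ℝ} (ht : t ∈ Icc a b) {v w : EuclideanSpace ℝ (Fin m)}
    (hv : v ∈ U) (hw : w ∈ U) :
    ∃ ψ, IsPath (box a b U) (pt t v) (pt t w) (C * ‖v - w‖) ψ := by
  obtain ⟨γ, hγU, hγ0, hγ1, ⟨γ', hint, hγ⟩, hvar⟩ := hW v hv w hw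
  have h0 : (0:ℝ) ∈ Icc (0:ℝ) 1 := by simp
  have h1 : (1:ℝ) ∈ Icc (0:ℝ) 1 := by simp
  have hintn := hint.norm
  have hsub : ∀ x ∈ Icc (0:ℝ) 1, ∀ y ∈ Icc (0:ℝ) 1, uIcc x y ⊆ uIcc (0:ℝ) 1 := fun x hx y hy => by
    rw [uIcc_of_le (zero_le_one)]; exact uIcc_subset_Icc hx hy
  obtain ⟨σ, ψ, l, hl0, -, hlv, -, hσ0, hσ1, hσ, hψ, hlip, -⟩ :=
    arclength (f := γ) (g := fun t => ∫ s in (0:ℝ)..t, ‖γ' s‖) zero_le_one (by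
      have := intervalIntegral.continuousOn_primitive_interval (μ := volume)
        (f := fun s => ‖γ' s‖) (a := 0) (b := 1) (by
          rw [uIcc_of_le zero_le_one, integrableOn_Icc_iff_integrableOn_Ioc]
          exact (intervalIntegrable_iff_integrableOn_Ioc_of_le zero_le_one).1 hintn)
      rwa [uIcc_of_le zero_le_one] at this) (by
      intro x hx y hy hxy
      have i0 : ∀ z ∈ Icc (0:ℝ) 1, IntervalIntegrable γ' volume 0 z := fun z hz =>
        hint.mono_set (hsub 0 h0 z hz)
      rw [intervalIntegral.integral_interval_sub_left (i0 y hy).norm (i0 x hx).norm, dist_comm,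
        dist_eq_norm, hγ y hy, hγ x hx, add_sub_add_left_eq_sub,
        intervalIntegral.integral_interval_sub_left (i0 y hy) (i0 x hx)]
      exact intervalIntegral.norm_integral_le_integral_norm hxy)
  have hnn : 0 ≤ C * ‖v - w‖ := by positivity
  have hlC : l ≤ C * ‖v - w‖ := by
    rw [← hlv] at hvar
    exact (ENNReal.ofReal_le_ofReal_iff hnn).1 hvar
  have hP : IsPath (box a b U) (pt t v) (pt t w) l (fun s => pt t (ψ s)) := by
    have clamp : ∀ s, ∀ r ∈ Icc (0:ℝ) 1, σ r = max 0 (min s l) → ψ s = ψ (σ r) := by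
      intro s r hr e
      obtain ⟨r', hr', e1, e2⟩ := hψ s
      rw [e1, ← (hσ r' hr').2, e2, e]
    refine ⟨hl0, ?_, ?_, ?_, ?_, ?_⟩
    · refine lip_one_of_le fun s s' hs => ?_
      rw [WithLp.prod_dist_eq_of_L1]
      simpa using le_of_lip_one hlip hs
    · intro s s' hs; simp
    · intro s
      obtain ⟨r, hr, e, -⟩ := hψ s
      exact ⟨ht, by simpa [e] using hγU r hr⟩
    · intro s hs
      have := clamp s 0 h0 (by rw [hσ0, max_eq_left]; exact (min_le_left _ _).trans hs)
      simp only [this, (hσ 0 h0).2, hγ0]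
    · intro s hs
      have := clamp s 1 h1 (by rw [hσ1, min_eq_right hs, max_eq_right hl0])
      simp only [this, (hσ 1 h1).2, hγ1]
  exact ⟨_, hP.enlarge hlC⟩

/-- The real variation between two points. -/
lemma var_step {E : Type*} [NormedAddCommGroup E] {u : ℝ → E} {a b : ℝ}
    (hBV : BoundedVariationOn u (Icc a b)) {t t' : ℝ} (ht : t ∈ Icc a b) (ht' : t' ∈ Icc a b)
    (h : t ≤ t') :
    variationOnFromTo u (Icc a b) a t + ‖u t - u t'‖ ≤ variationOnFromTo u (Icc a b) a t' := by
  have hLB := hBV.locallyBoundedVariationOn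
  have ha : a ∈ Icc a b := ⟨le_rfl, ht.1.trans ht.2⟩
  rw [← variationOnFromTo.add hLB ha ht ht', variationOnFromTo.eq_of_le u _ h, ← dist_eq_norm]
  gcongr
  rw [dist_edist]
  refine ENNReal.toReal_mono (hLB t t' ht ht') (eVariationOn.edist_le u ?_ ?_)
  · exact ⟨ht, le_rfl, h⟩
  · exact ⟨ht', h, le_rfl⟩

/-- Joining two points of the graph. -/
lemma path_step {m : ℕ} {U : Set (EuclideanSpace ℝ (Fin m))} {C : ℝ} (hW : WhitneyWith U C)
    (hC : 1 ≤ C) {a b t t' : ℝ} (ht : t ∈ Icc a b) (ht' : t' ∈ Icc a b) (h : t ≤ t')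
    {v w : EuclideanSpace ℝ (Fin m)} (hv : v ∈ U) (hw : w ∈ U) :
    ∃ ψ, IsPath (box a b U) (pt t v) (pt t' w) ((t' - t) + C * ‖v - w‖) ψ := by
  obtain ⟨ψ1, h1⟩ := path_time hv ht ht' h
  obtain ⟨ψ2, h2⟩ := path_whitney hW hC ht' hv hw
  exact ⟨_, h1.concat h2⟩

lemma path_finset {m : ℕ} {U : Set (EuclideanSpace ℝ (Fin m))} {C : ℝ} (hW : WhitneyWith U C)
    (hC : 1 ≤ C) {a b : ℝ} {u : ℝ → EuclideanSpace ℝ (Fin m)}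
    (huU : ∀ t ∈ Icc a b, u t ∈ U) (hBV : BoundedVariationOn u (Icc a b)) (F : Finset ℝ) :
    ∀ t ∈ Icc a b, (∀ r ∈ F, r ∈ Icc a t) →
    ∃ ψ, IsPath (box a b U) (pt a (u a)) (pt t (u t))
      ((t - a) + C * variationOnFromTo u (Icc a b) a t) ψ ∧
      ∀ r ∈ F, ∃ s ∈ Icc 0 ((t - a) + C * variationOnFromTo u (Icc a b) a t),
        ψ s = pt r (u r) := by
  have hC0 : 0 ≤ C := by linarith
  induction F using Finset.induction_on_max with
  | empty =>
    intro t ht _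
    have ha : a ∈ Icc a b := ⟨le_rfl, ht.1.trans ht.2⟩
    obtain ⟨ψ, h⟩ := path_step hW hC ha ht ht.1 (huU a ha) (huU t ht)
    refine ⟨ψ, h.enlarge ?_, by simp⟩
    have := var_step hBV ha ht ht.1
    rw [variationOnFromTo.self, zero_add] at this
    gcongr
  | insert r F hmax ih =>
    intro t ht hF
    have hr := hF r (Finset.mem_insert_self _ _)
    have hrb : r ∈ Icc a b := ⟨hr.1, hr.2.trans ht.2⟩
    obtain ⟨ψ1, h1, hit⟩ := ih r hrb (fun x hx =>
      ⟨(hF x (Finset.mem_insert_of_mem hx)).1, (hmax x hx).le⟩)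
    obtain ⟨ψ2, h2⟩ := path_step hW hC hrb ht hr.2 (huU r hrb) (huU t ht)
    have hvs := var_step hBV hrb ht hr.2
    set V1 := variationOnFromTo u (Icc a b) a r
    set V2 := variationOnFromTo u (Icc a b) a t
    have hlen : (r - a + C * V1) + ((t - r) + C * ‖u r - u t‖) ≤ (t - a) + C * V2 := by
      have := mul_le_mul_of_nonneg_left hvs hC0
      linarith
    have hlen1 : r - a + C * V1 ≤ (t - a) + C * V2 := by
      have := h2.nonneg
      linarith
    refine ⟨_, (h1.concat h2).enlarge hlen, ?_⟩
    intro x hx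
    rcases Finset.mem_insert.1 hx with rfl | hx
    · refine ⟨x - a + C * V1, ⟨h1.nonneg, hlen1⟩, ?_⟩
      simp only [le_refl, if_true]
      exact h1.right _ le_rfl
    · obtain ⟨s, hs, e⟩ := hit x hx
      refine ⟨s, ⟨hs.1, hs.2.trans hlen1⟩, ?_⟩
      simp only [hs.2, if_true]
      exact e

lemma isCompact_box {E : Type*} [NormedAddCommGroup E] {U : Set E} (hU : IsCompact U) (a b : ℝ) :
    IsCompact (box a b U) := by
  have h := ((isCompact_Icc (a := a) (b := b)).prod hU).image
    (WithLp.prod_continuous_toLp 1 ℝ E)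
  convert h using 1
  ext w
  constructor
  · intro hw
    exact ⟨(w.fst, w.snd), ⟨hw.1, hw.2⟩, rfl⟩
  · rintro ⟨x, hx, rfl⟩
    exact ⟨hx.1, hx.2⟩

/-- The graph completion of `u`, not yet parametrized by arc length. -/
lemma path_graph {m : ℕ} {U : Set (EuclideanSpace ℝ (Fin m))} (hUcomp : IsCompact U) {C : ℝ}
    (hW : WhitneyWith U C) (hC : 1 ≤ C) {a b : ℝ} (hab : a < b)
    {u : ℝ → EuclideanSpace ℝ (Fin m)}
    (huU : ∀ t ∈ Icc a b, u t ∈ U) (hBV : BoundedVariationOn u (Icc a b)) :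
    ∃ ψ, IsPath (box a b U) (pt a (u a)) (pt b (u b))
      ((b - a) + C * (eVariationOn u (Icc a b)).toReal) ψ ∧
      ∀ t ∈ Icc a b, ∃ s ∈ Icc 0 ((b - a) + C * (eVariationOn u (Icc a b)).toReal),
        ψ s = pt t (u t) := by
  have hb : b ∈ Icc a b := right_mem_Icc.2 hab.le
  have hV : variationOnFromTo u (Icc a b) a b = (eVariationOn u (Icc a b)).toReal := by
    rw [variationOnFromTo.eq_of_le u _ hab.le, inter_self]
  set L := (b - a) + C * (eVariationOn u (Icc a b)).toReal with hL
  have key : ∀ F : Finset (Icc a b), ∃ ψ, IsPath (box a b U) (pt a (u a)) (pt b (u b)) L ψ ∧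
      ∀ t : Icc a b, ∃ s ∈ Icc 0 L, t ∈ F → ψ s = pt (t:ℝ) (u t) := by
    intro F
    obtain ⟨ψ, h1, h2⟩ := path_finset hW hC huU hBV (F.image Subtype.val) b hb (by
      intro r hr
      obtain ⟨x, -, rfl⟩ := Finset.mem_image.1 hr
      exact x.2)
    rw [hV, ← hL] at h1 h2
    refine ⟨ψ, h1, fun t => ?_⟩
    by_cases ht : t ∈ F
    · obtain ⟨s, hs, e⟩ := h2 t (Finset.mem_image_of_mem _ ht)
      exact ⟨s, hs, fun _ => e⟩
    · exact ⟨0, ⟨le_rfl, h1.nonneg⟩, fun h => absurd h ht⟩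
  choose Ψ hΨ τ hτ hΨτ using key
  let 𝒰 : Ultrafilter (Finset (Icc a b)) := Ultrafilter.of atTop
  have h𝒰 : (𝒰 : Filter (Finset (Icc a b))) ≤ atTop := Ultrafilter.of_le _
  have lims : ∀ s, ∃ w ∈ box a b U, Tendsto (fun F => Ψ F s) 𝒰 (𝓝 w) := by
    intro s
    exact (isCompact_box hUcomp a b).ultrafilter_le_nhds (𝒰.map (fun F => Ψ F s))
      (by
        rw [Ultrafilter.coe_map, Filter.le_principal_iff, Filter.mem_map]
        exact Filter.univ_mem' fun F => (hΨ F).mem s)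
  choose ψ hψm hψ using lims
  have hlip : LipschitzWith 1 ψ := lip_one_of_le fun s s' hs =>
    le_of_tendsto ((hψ s).dist (hψ s')) (Filter.univ_mem' fun F => le_of_lip_one (hΨ F).lip hs)
  refine ⟨ψ, ⟨(hΨ ∅).nonneg, hlip, ?_, hψm, ?_, ?_⟩, ?_⟩
  · intro s s' hs
    have hc : Continuous (fun w : TS (EuclideanSpace ℝ (Fin m)) => w.fst) :=
      WithLp.continuous_fst 1 ℝ _
    exact le_of_tendsto_of_tendsto ((hc.tendsto _).comp (hψ s)) ((hc.tendsto _).comp (hψ s'))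
      (Filter.univ_mem' fun F => (hΨ F).mono hs)
  · intro s hs
    refine tendsto_nhds_unique (hψ s) (tendsto_const_nhds.congr fun F => ?_)
    exact ((hΨ F).left s hs).symm
  · intro s hs
    refine tendsto_nhds_unique (hψ s) (tendsto_const_nhds.congr fun F => ?_)
    exact ((hΨ F).right s hs).symm
  · intro t ht
    obtain ⟨s, hs, hlim⟩ := (isCompact_Icc (a := (0:ℝ)) (b := L)).ultrafilter_le_nhds
      (𝒰.map (fun F => τ F ⟨t, ht⟩)) (by
        rw [Ultrafilter.coe_map, Filter.le_principal_iff, Filter.mem_map]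
        exact Filter.univ_mem' fun F => hτ F ⟨t, ht⟩)
    have hlim' : Tendsto (fun F => τ F ⟨t, ht⟩) 𝒰 (𝓝 s) := hlim
    refine ⟨s, hs, ?_⟩
    refine tendsto_nhds_unique (hψ s) ?_
    rw [tendsto_iff_dist_tendsto_zero]
    have hd : Tendsto (fun F => dist s (τ F ⟨t, ht⟩)) 𝒰 (𝓝 0) := by
      simpa using (tendsto_const_nhds (x := s)).dist hlim'
    refine squeeze_zero' (Filter.Eventually.of_forall fun _ => dist_nonneg) ?_ hd
    have hev : ∀ᶠ F in (𝒰 : Filter (Finset (Icc a b))), {⟨t, ht⟩} ≤ F := h𝒰 (eventually_ge_atTop _)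
    filter_upwards [hev] with F hF
    have e := hΨτ F ⟨t, ht⟩ (hF (Finset.mem_singleton_self _))
    rw [← e]
    simpa using (hΨ F).lip.dist_le_mul s (τ F ⟨t, ht⟩)

/-- Lemma 5.1 (i) of the paper: construction of a graph completion on `[a,b]`,
with the stated bounds on its (arc-length) parameter interval. -/
theorem stmt0 {m : ℕ} (U : Set (EuclideanSpace ℝ (Fin m))) (hUcomp : IsCompact U)
    (C : ℝ) (hC : 1 ≤ C) (hW : WhitneyWith U C)
    (a b : ℝ) (hab : a < b) (u : ℝ → EuclideanSpace ℝ (Fin m))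
    (huU : ∀ t ∈ Icc a b, u t ∈ U) (hBV : BoundedVariationOn u (Icc a b))
    (ub1 : EuclideanSpace ℝ (Fin m)) (hub1 : ub1 ∈ U) :
    ∃ St > 0, ∃ S ∈ Icc (0:ℝ) St,
      ∃ (phi0 : ℝ → ℝ) (phi : ℝ → EuclideanSpace ℝ (Fin m)),
      -- (φ₀,φ) is 1-Lipschitz on [0,S̃]
      (∀ s1 ∈ Icc (0:ℝ) St, ∀ s2 ∈ Icc (0:ℝ) St,
        |phi0 s1 - phi0 s2| + ‖phi s1 - phi s2‖ ≤ |s1 - s2|) ∧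
      -- φ₀ nondecreasing
      MonotoneOn phi0 (Icc 0 St) ∧
      -- φ₀' + |φ'| = 1 a.e.
      (∀ᵐ s ∂volume, s ∈ Ioo (0:ℝ) St → deriv phi0 s + ‖deriv phi s‖ = 1) ∧
      -- (φ₀,φ) maps into [a,b] × U
      (∀ s ∈ Icc (0:ℝ) St, phi0 s ∈ Icc a b ∧ phi s ∈ U) ∧
      -- initial condition
      phi0 0 = a ∧ phi 0 = u a ∧
      -- the graph of u is covered
      (∀ t ∈ Icc a b, ∃ s ∈ Icc (0:ℝ) St, phi0 s = t ∧ phi s = u t) ∧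
      -- endpoint values
      phi0 St = b ∧ phi St = u b ∧ phi0 S = b ∧ phi S = ub1 ∧
      -- the bounds on S and S̃
      (b - a) + (eVariationOn u (Icc a b)).toReal + ‖u b - ub1‖ ≤ S ∧
      St ≤ (b - a) + 2 * C * ((eVariationOn u (Icc a b)).toReal + ‖u b - ub1‖) := by
  obtain ⟨ψ0, hψ0, hit⟩ := path_graph hUcomp hW hC hab huU hBV
  set V := (eVariationOn u (Icc a b)).toReal with hV
  set L := (b - a) + C * V with hL
  set d := ‖u b - ub1‖ with hd
  have ha : a ∈ Icc a b := left_mem_Icc.2 hab.le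
  have hb : b ∈ Icc a b := right_mem_Icc.2 hab.le
  have hV0 : 0 ≤ V := ENNReal.toReal_nonneg
  have hd0 : 0 ≤ d := norm_nonneg _
  obtain ⟨ψ1, hψ1⟩ := path_whitney hW hC hb (huU b hb) hub1
  obtain ⟨ψ2, hψ2⟩ := path_whitney hW hC hb hub1 (huU b hb)
  rw [norm_sub_rev, ← hd] at hψ2
  rw [← hd] at hψ1
  have h01 := hψ0.concat hψ1
  have hΓ := h01.concat hψ2
  have hL0 := hψ0.nonneg
  have hCd := hψ1.nonneg
  set Γ : ℝ → TS (EuclideanSpace ℝ (Fin m)) := fun s => if s ≤ L + C * d then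
    (if s ≤ L then ψ0 s else ψ1 (s - L)) else ψ2 (s - (L + C * d)) with hΓdef
  have hΓ0 : ∀ s ≤ L, Γ s = ψ0 s := fun s hs => by
    have : s ≤ L + C * d := by linarith
    simp only [hΓdef, this, hs, if_true]
  have hΓ1 : Γ (L + C * d) = pt b ub1 := by
    simp only [hΓdef, le_refl, if_true]
    exact h01.right _ le_rfl
  set T := L + C * d + C * d with hT
  have hT0 : 0 ≤ T := hΓ.nonneg
  obtain ⟨σ, ψ, St, hSt0, hStT, -, hσm, hσ0, hσT, hσ, hψ, hlip, hvar⟩ :=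
    arclength (f := Γ) (g := fun s => s) hT0 continuousOn_id
      (fun x _ y _ hxy => le_of_lip_one hΓ.lip hxy)
  have hmono : Monotone (fun s => (ψ s).fst) := by
    intro s s' hs
    obtain ⟨r, hr, e, es⟩ := hψ s
    obtain ⟨r', hr', e', es'⟩ := hψ s'
    simp only [e, e']
    rcases le_total r r' with h | h
    · exact hΓ.mono h
    · have h1 := hσm hr' hr h
      have h2 : σ r ≤ σ r' := by rw [es, es']; gcongr
      have h3 : σ r = σ r' := le_antisymm h2 h1
      rw [← (hσ r hr).2, ← (hσ r' hr').2, h3]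
  have hmL : L ∈ Icc 0 T := ⟨hL0, by linarith⟩
  have hmS : L + C * d ∈ Icc 0 T := ⟨by linarith, by linarith⟩
  have hmT : T ∈ Icc 0 T := ⟨hT0, le_rfl⟩
  have hm0 : (0:ℝ) ∈ Icc 0 T := ⟨le_rfl, hT0⟩
  have hψ_0 : ψ 0 = pt a (u a) := by
    rw [← hσ0, (hσ 0 hm0).2]; exact hΓ.left 0 le_rfl
  have hψ_T : ψ St = pt b (u b) := by
    rw [← hσT, (hσ T hmT).2]; exact hΓ.right T le_rfl
  have hψ_S : ψ (σ (L + C * d)) = pt b ub1 := by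
    rw [(hσ _ hmS).2, hΓ1]
  have hψ_L : ψ (σ L) = pt b (u b) := by
    rw [(hσ _ hmL).2, hΓ0 L le_rfl]; exact hψ0.right L le_rfl
  have hdist : ∀ s s', dist (ψ s) (ψ s') = |(ψ s).fst - (ψ s').fst| + ‖(ψ s).snd - (ψ s').snd‖ := by
    intro s s'
    rw [WithLp.prod_dist_eq_of_L1, Real.dist_eq, dist_eq_norm]
  -- hitting times
  have hit' : ∀ t, ∃ s, t ∈ Icc a b → s ∈ Icc 0 (σ L) ∧ ψ s = pt t (u t) := by
    intro t
    by_cases ht : t ∈ Icc a b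
    · obtain ⟨s, hs, e⟩ := hit t ht
      have hsT : s ∈ Icc 0 T := ⟨hs.1, hs.2.trans hmL.2⟩
      refine ⟨σ s, fun _ => ⟨⟨(hσ s hsT).1.1, hσm hsT hmL hs.2⟩, ?_⟩⟩
      rw [(hσ s hsT).2, hΓ0 s hs.2, e]
    · exact ⟨0, fun h => absurd h ht⟩
  choose ρ hρ using hit'
  have hσLT : σ L ≤ St := (hσ L hmL).1.2
  -- lower bound
  have hlow : V ≤ (ρ b - b) - (ρ a - a) := by
    have hctl : ∀ x ∈ Icc a b, ∀ y ∈ Icc a b, x ≤ y →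
        dist (u x) (u y) ≤ (ρ y - y) - (ρ x - x) := by
      intro x hx y hy hxy
      rcases hxy.eq_or_lt with rfl | hlt
      · simp
      have hle : ρ x ≤ ρ y := by
        by_contra hcon
        have := hmono (le_of_not_ge hcon)
        simp only [(hρ x hx).2, (hρ y hy).2] at this
        exact absurd hlt (not_lt.2 this)
      have h1 := le_of_lip_one hlip hle
      rw [hdist, (hρ x hx).2, (hρ y hy).2] at h1
      simp only [WithLp.toLp_fst, WithLp.toLp_snd] at h1
      rw [abs_sub_comm, abs_of_pos (by linarith)] at h1
      rw [dist_eq_norm]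
      linarith
    have h1 := var_le_of_control (g := fun t => ρ t - t) hctl
    exact ENNReal.toReal_le_of_le_ofReal (dist_nonneg.trans (hctl a ha b hb hab.le)) h1
  have hlow2 : d ≤ σ (L + C * d) - σ L := by
    have h1 := le_of_lip_one hlip (hσm hmL hmS (by linarith))
    rw [hdist, hψ_S, hψ_L] at h1
    simpa using h1
  have hρa := (hρ a ha).1.1
  have hρb := (hρ b hb).1.2
  have hS := (hσ _ hmS).1
  refine ⟨St, ?_, σ (L + C * d), hS, fun s => (ψ s).fst, fun s => (ψ s).snd, ?_, hmono.monotoneOn _,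
    ?_, ?_, ?_, ?_, ?_, ?_, ?_, ?_, ?_, ?_, ?_⟩
  · have := hS.2
    linarith
  · intro s1 _ s2 _
    rw [← hdist]
    simpa [Real.dist_eq] using hlip.dist_le_mul s1 s2
  · filter_upwards [unit_speed_deriv hlip hSt0 hvar, hlip.ae_differentiableAt_real] with s h1 h2 hs
    have e1 : deriv (fun s => (ψ s).fst) s = (deriv ψ s).fst :=
      ((WithLp.fstL 1 ℝ ℝ (EuclideanSpace ℝ (Fin m))).hasFDerivAt.comp_hasDerivAt s
        h2.hasDerivAt).deriv
    have e2 : deriv (fun s => (ψ s).snd) s = (deriv ψ s).snd :=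
      ((WithLp.sndL 1 ℝ ℝ (EuclideanSpace ℝ (Fin m))).hasFDerivAt.comp_hasDerivAt s
        h2.hasDerivAt).deriv
    have h3 : 0 ≤ deriv (fun s => (ψ s).fst) s := hmono.deriv_nonneg
    have h4 := h1 hs
    rw [WithLp.prod_norm_eq_of_L1, ← e1, ← e2, Real.norm_of_nonneg h3] at h4
    exact h4
  · intro s _
    obtain ⟨r, _, e, -⟩ := hψ s
    have := hΓ.mem r
    rw [← e] at this
    exact this
  · simp only [hψ_0, WithLp.toLp_fst, WithLp.toLp_snd]
  · simp only [hψ_0, WithLp.toLp_fst, WithLp.toLp_snd]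
  · intro t ht
    refine ⟨ρ t, ⟨(hρ t ht).1.1, (hρ t ht).1.2.trans hσLT⟩, ?_, ?_⟩ <;> simp only [(hρ t ht).2, WithLp.toLp_fst, WithLp.toLp_snd]
  · simp only [hψ_T, WithLp.toLp_fst, WithLp.toLp_snd]
  · simp only [hψ_T, WithLp.toLp_fst, WithLp.toLp_snd]
  · simp only [hψ_S, WithLp.toLp_fst, WithLp.toLp_snd]
  · simp only [hψ_S, WithLp.toLp_fst, WithLp.toLp_snd]
  · linarith
  · have : 0 ≤ C * V := mul_nonneg (by linarith) hV0
    simp only [hT, hL] at hStT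
    linarith

end
end

section
/- Assume the standing hypotheses on the data g₀, g₁, …, g_m and the compact sets U, V. Let 0 < S̃ ≤ S ≤ +∞, T̃ > 0, and let (φ₀,φ) : [0,S) → ℝ₊ × U be 1-Lipschitz with φ₀ nondecreasing, φ₀(0)=0, φ₀'(s)+|φ'(s)| = 1 a.e., and let ψ : [0,S) → V be Borel measurable. Let σ : [0,T̃] → [0,S̃] be an increasing map with φ₀(σ(t)) = t for every t ∈ [0,T̃], σ(0)=0, σ(T̃)=S̃, and set v := ψ∘σ. If ξ and ξ̃ are space-time solutions with initial datum x̄₀ corresponding to the controls (φ₀,φ,ψ) and (φ₀,φ,v∘φ₀) respectively, then ξ(s) = ξ̃(s) for every s ∈ [0,S̃]. -/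
open MeasureTheory Set Filter Topology
open scoped ENNReal

noncomputable section

/-- Standing hypotheses on the data of the impulsive control system. -/
def StandingHyp {n m q : ℕ} (U : Set (EuclideanSpace ℝ (Fin m)))
    (V : Set (EuclideanSpace ℝ (Fin q)))
    (g0 : EuclideanSpace ℝ (Fin n) → EuclideanSpace ℝ (Fin m) → EuclideanSpace ℝ (Fin q) →
      EuclideanSpace ℝ (Fin n))
    (g : Fin m → EuclideanSpace ℝ (Fin n) → EuclideanSpace ℝ (Fin m) →
      EuclideanSpace ℝ (Fin n))
    (M : ℝ) : Prop :=
  IsCompact U ∧ IsCompact V ∧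
  -- g₀ continuous on ℝⁿ × U × V
  ContinuousOn (fun p : (EuclideanSpace ℝ (Fin n) × EuclideanSpace ℝ (Fin m)) ×
      EuclideanSpace ℝ (Fin q) => g0 p.1.1 p.1.2 p.2) ((univ ×ˢ U) ×ˢ V) ∧
  -- (x,u) ↦ g₀(x,u,v) locally Lipschitz, uniformly in v ∈ V
  (∀ R > (0:ℝ), ∃ L ≥ (0:ℝ), ∀ v' ∈ V, ∀ x1 x2 : EuclideanSpace ℝ (Fin n),
    ∀ u1 ∈ U, ∀ u2 ∈ U, ‖x1‖ ≤ R → ‖x2‖ ≤ R →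
      ‖g0 x1 u1 v' - g0 x2 u2 v'‖ ≤ L * (‖x1 - x2‖ + ‖u1 - u2‖)) ∧
  -- each gᵢ locally Lipschitz
  (∀ i : Fin m, ∀ R > (0:ℝ), ∃ L ≥ (0:ℝ), ∀ x1 x2 : EuclideanSpace ℝ (Fin n),
    ∀ u1 ∈ U, ∀ u2 ∈ U, ‖x1‖ ≤ R → ‖x2‖ ≤ R →
      ‖g i x1 u1 - g i x2 u2‖ ≤ L * (‖x1 - x2‖ + ‖u1 - u2‖)) ∧
  -- sublinear growth: |(g₀,g₁,…,g_m)| ≤ M(1+|(x,u)|)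
  0 < M ∧
  ∀ (x : EuclideanSpace ℝ (Fin n)), ∀ u' ∈ U, ∀ v' ∈ V,
    Real.sqrt (‖g0 x u' v'‖ ^ 2 + ∑ i, ‖g i x u'‖ ^ 2) ≤
      M * (1 + Real.sqrt (‖x‖ ^ 2 + ‖u'‖ ^ 2))

/-- `ξ` is a space-time solution with initial datum `x0` corresponding to `(φ₀,φ,ψ)`,
on the domain `D`. -/
def IsSTSol {n m q : ℕ}
    (g0 : EuclideanSpace ℝ (Fin n) → EuclideanSpace ℝ (Fin m) → EuclideanSpace ℝ (Fin q) →
      EuclideanSpace ℝ (Fin n))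
    (g : Fin m → EuclideanSpace ℝ (Fin n) → EuclideanSpace ℝ (Fin m) →
      EuclideanSpace ℝ (Fin n))
    (x0 : EuclideanSpace ℝ (Fin n)) (phi0 : ℝ → ℝ) (phi : ℝ → EuclideanSpace ℝ (Fin m))
    (psi : ℝ → EuclideanSpace ℝ (Fin q)) (xi : ℝ → EuclideanSpace ℝ (Fin n))
    (D : Set ℝ) : Prop :=
  ∀ s ∈ D, xi s = x0 + ∫ r in (0:ℝ)..s,
    ((deriv phi0 r) • g0 (xi r) (phi r) (psi r) +
      ∑ i, ((deriv phi r) i) • g i (xi r) (phi r))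

/-- Integral form of the Gronwall inequality. -/
lemma aux_gronwall {u : ℝ → ℝ} {a K T : ℝ} (hT : 0 ≤ T) (hu : ContinuousOn u (Icc 0 T))
    (hu0 : ∀ t ∈ Icc 0 T, 0 ≤ u t) (hK : 0 ≤ K) (ha : 0 ≤ a)
    (h : ∀ t ∈ Icc 0 T, u t ≤ a + K * ∫ r in (0:ℝ)..t, u r) :
    ∀ t ∈ Icc 0 T, u t ≤ a * Real.exp (K * t) := by
  set w : ℝ → ℝ := IccExtend hT ((Icc 0 T).domRestrict u) with hw
  have hwc : Continuous w := (continuousOn_iff_continuous_domRestrict.1 hu).Icc_extend'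
  have hwu : ∀ t ∈ Icc 0 T, w t = u t := fun t ht => by
    rw [hw, IccExtend_of_mem _ _ ht]; rfl
  have hint : ∀ t ∈ Icc 0 T, ∫ r in (0:ℝ)..t, w r = ∫ r in (0:ℝ)..t, u r := by
    intro t ht
    apply intervalIntegral.integral_congr
    intro r hr
    rw [uIcc_of_le ht.1] at hr
    exact hwu r ⟨hr.1, hr.2.trans ht.2⟩
  set G : ℝ → ℝ := fun t => a + K * ∫ r in (0:ℝ)..t, w r with hG
  have hGd : ∀ t, HasDerivAt G (K * w t) t := fun t =>
    ((intervalIntegral.integral_hasDerivAt_right (hwc.intervalIntegrable _ _)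
      (hwc.stronglyMeasurableAtFilter _ _) hwc.continuousAt).const_mul K).const_add a
  have hle : ∀ t ∈ Icc 0 T, w t ≤ G t := fun t ht => by
    rw [hwu t ht, hG]; simp only; rw [hint t ht]; exact h t ht
  have key := norm_le_gronwallBound_of_norm_deriv_right_le (f := G) (f' := fun t => K * w t)
    (δ := a) (K := K) (ε := 0) (a := 0) (b := T)
    (fun t _ => (hGd t).continuousAt.continuousWithinAt)
    (fun t _ => (hGd t).hasDerivWithinAt) (by simp [hG, abs_of_nonneg ha])
    (fun t ht => by
      have ht' := Ico_subset_Icc_self ht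
      have h0 : 0 ≤ w t := by rw [hwu t ht']; exact hu0 t ht'
      rw [add_zero, norm_mul, Real.norm_of_nonneg hK, Real.norm_of_nonneg h0]
      exact mul_le_mul_of_nonneg_left ((hle t ht').trans (le_abs_self _)) hK)
  intro t ht
  have := key t ht
  rw [gronwallBound_ε0, sub_zero] at this
  exact (hwu t ht ▸ hle t ht).trans ((le_abs_self _).trans this)

section aux
variable {E : Type*} [NormedAddCommGroup E] [NormedSpace ℝ E]

/-- A solution of a Caratheodory integral equation is automatically regular. -/
lemma aux_regular {T C : ℝ} (hT : 0 ≤ T) (hC : 0 ≤ C) (F : E → ℝ → E)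
    (hmeas : ∀ x : ℝ → E, AEStronglyMeasurable x (volume.restrict (Ioc 0 T)) →
      AEStronglyMeasurable (fun r => F (x r) r) (volume.restrict (Ioc 0 T)))
    (hgr : ∀ᵐ r ∂(volume.restrict (Ioc 0 T)), ∀ x, ‖F x r‖ ≤ C * (1 + ‖x‖))
    (x0 : E) (x : ℝ → E)
    (hx : ∀ s ∈ Icc 0 T, x s = x0 + ∫ r in (0:ℝ)..s, F (x r) r) :
    IntervalIntegrable (fun r => F (x r) r) volume 0 T ∧ ContinuousOn x (Icc 0 T) := by
  set f : ℝ → E := fun r => F (x r) r with hf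
  have hcont : ∀ s ∈ Icc 0 T, IntervalIntegrable f volume 0 s → ContinuousOn x (Icc 0 s) := by
    intro s hs hi
    have h1 := intervalIntegral.continuousOn_primitive_interval' hi (left_mem_uIcc)
    rw [uIcc_of_le hs.1] at h1
    exact (continuousOn_const.add h1).congr fun t ht => hx t ⟨ht.1, ht.2.trans hs.2⟩
  set I : Set ℝ := {s | s ∈ Icc 0 T ∧ IntervalIntegrable f volume 0 s} with hI
  have hdown : ∀ s ∈ I, ∀ t, 0 ≤ t → t ≤ s → t ∈ I := by
    intro s hs t h0 hts
    refine ⟨⟨h0, hts.trans hs.1.2⟩, hs.2.mono_set ?_⟩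
    rw [uIcc_of_le h0, uIcc_of_le hs.1.1]
    exact Icc_subset_Icc_right hts
  have hIm : MeasurableSet I := by
    apply Set.OrdConnected.measurableSet
    exact ⟨fun a ha b hb t ht => hdown b hb t (ha.1.1.trans ht.1) ht.2⟩
  have hIc : ContinuousOn x I := by
    intro s hs
    by_cases h : ∃ s' ∈ I, s < s'
    · obtain ⟨s', hs', hlt⟩ := h
      refine (hcont s' hs'.1 hs'.2 s ⟨hs.1.1, hlt.le⟩).mono_of_mem_nhdsWithin ?_
      filter_upwards [self_mem_nhdsWithin, mem_nhdsWithin_of_mem_nhds (Iio_mem_nhds hlt)]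
        with t ht ht'
      exact ⟨ht.1.1, le_of_lt ht'⟩
    · push Not at h
      exact (hcont s hs.1 hs.2 s ⟨hs.1.1, le_rfl⟩).mono fun t ht => ⟨ht.1.1, h t ht⟩
  have hxm : AEStronglyMeasurable x (volume.restrict (Ioc 0 T)) := by
    have hsub : Ioc 0 T ⊆ I ∪ (Ioc 0 T \ I) := fun t ht => by
      by_cases h : t ∈ I
      · exact Or.inl h
      · exact Or.inr ⟨ht, h⟩
    refine AEStronglyMeasurable.mono_set hsub ?_
    rw [aestronglyMeasurable_union_iff]
    refine ⟨hIc.aestronglyMeasurable hIm, ?_⟩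
    refine (aestronglyMeasurable_const (b := x0)).congr ?_
    filter_upwards [ae_restrict_mem (measurableSet_Ioc.diff hIm)] with t ht
    have htI : t ∈ Icc 0 T := Ioc_subset_Icc_self ht.1
    rw [hx t htI, intervalIntegral.integral_undef (fun h => ht.2 ⟨htI, h⟩), add_zero]
  set B : ℝ := (1 + ‖x0‖) * Real.exp (C * T) with hB
  have hexp : 1 ≤ Real.exp (C * T) := Real.one_le_exp (mul_nonneg hC hT)
  have hbound : ∀ s ∈ Icc 0 T, 1 + ‖x s‖ ≤ B := by
    intro s hs
    by_cases hsI : s ∈ I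
    · have hcs := hcont s hs hsI.2
      have hu : ContinuousOn (fun t => 1 + ‖x t‖) (Icc 0 s) := continuousOn_const.add hcs.norm
      have := aux_gronwall (u := fun t => 1 + ‖x t‖) (a := 1 + ‖x0‖) (K := C) hs.1 hu
        (fun t _ => by positivity) hC (by positivity) (fun t ht => by
          have htT : t ∈ Icc 0 T := ⟨ht.1, ht.2.trans hs.2⟩
          have h1 : ‖∫ r in (0:ℝ)..t, f r‖ ≤ ∫ r in (0:ℝ)..t, C * (1 + ‖x r‖) := by
            apply intervalIntegral.norm_integral_le_of_norm_le ht.1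
            · have := (ae_restrict_iff' measurableSet_Ioc).1 hgr
              filter_upwards [this] with r hr hrt
              exact hr ⟨hrt.1, hrt.2.trans htT.2⟩ (x r)
            · apply ContinuousOn.intervalIntegrable
              rw [uIcc_of_le ht.1]
              exact (continuousOn_const.mul hu).mono (Icc_subset_Icc_right ht.2)
          rw [intervalIntegral.integral_const_mul] at h1
          have h2 : ‖x t‖ ≤ ‖x0‖ + ‖∫ r in (0:ℝ)..t, f r‖ := by
            rw [hx t htT]; exact norm_add_le _ _
          linarith) s ⟨hs.1, le_rfl⟩
      refine this.trans ?_
      rw [hB]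
      have := hs.2
      gcongr
    · rw [hx s hs, intervalIntegral.integral_undef (fun h => hsI ⟨hs, h⟩), add_zero]
      exact le_mul_of_one_le_right (by positivity) hexp
  have hint : IntervalIntegrable f volume 0 T := by
    rw [intervalIntegrable_iff_integrableOn_Ioc_of_le hT]
    refine ⟨hmeas x hxm, .restrict_of_bounded (C := C * B) measure_Ioc_lt_top ?_⟩
    filter_upwards [hgr, ae_restrict_mem measurableSet_Ioc] with r hr hrT
    exact (hr (x r)).trans
      (mul_le_mul_of_nonneg_left (hbound r (Ioc_subset_Icc_self hrT)) hC)
  exact ⟨hint, hcont T ⟨hT, le_rfl⟩ hint⟩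

/-- Uniqueness for Caratheodory integral equations. -/
lemma aux_unique {T C : ℝ} (hT : 0 ≤ T) (hC : 0 ≤ C) (F : E → ℝ → E)
    (hmeas : ∀ x : ℝ → E, AEStronglyMeasurable x (volume.restrict (Ioc 0 T)) →
      AEStronglyMeasurable (fun r => F (x r) r) (volume.restrict (Ioc 0 T)))
    (hgr : ∀ᵐ r ∂(volume.restrict (Ioc 0 T)), ∀ x, ‖F x r‖ ≤ C * (1 + ‖x‖))
    (hlip : ∀ R > (0:ℝ), ∃ L ≥ (0:ℝ), ∀ᵐ r ∂(volume.restrict (Ioc 0 T)), ∀ x1 x2,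
      ‖x1‖ ≤ R → ‖x2‖ ≤ R → ‖F x1 r - F x2 r‖ ≤ L * ‖x1 - x2‖)
    (x0 : E) (x y : ℝ → E)
    (hx : ∀ s ∈ Icc 0 T, x s = x0 + ∫ r in (0:ℝ)..s, F (x r) r)
    (hy : ∀ s ∈ Icc 0 T, y s = x0 + ∫ r in (0:ℝ)..s, F (y r) r) :
    ∀ s ∈ Icc 0 T, x s = y s := by
  obtain ⟨hxi, hxc⟩ := aux_regular hT hC F hmeas hgr x0 x hx
  obtain ⟨hyi, hyc⟩ := aux_regular hT hC F hmeas hgr x0 y hy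
  obtain ⟨Rx, hRx⟩ := isCompact_Icc.exists_bound_of_continuousOn hxc
  obtain ⟨Ry, hRy⟩ := isCompact_Icc.exists_bound_of_continuousOn hyc
  obtain ⟨L, hL, hl⟩ := hlip (max 1 (max Rx Ry)) (by positivity)
  have hu : ContinuousOn (fun t => ‖x t - y t‖) (Icc 0 T) := (hxc.sub hyc).norm
  intro s hs
  have := aux_gronwall (u := fun t => ‖x t - y t‖) (a := 0) (K := L) hT hu
    (fun t _ => norm_nonneg _) hL le_rfl (fun t ht => by
      have hsub : uIcc 0 t ⊆ uIcc 0 T := by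
        rw [uIcc_of_le ht.1, uIcc_of_le hT]; exact Icc_subset_Icc_right ht.2
      have h1 : x t - y t = ∫ r in (0:ℝ)..t, (F (x r) r - F (y r) r) := by
        rw [intervalIntegral.integral_sub (hxi.mono_set hsub) (hyi.mono_set hsub),
          hx t ht, hy t ht, add_sub_add_left_eq_sub]
      rw [h1, zero_add, ← intervalIntegral.integral_const_mul]
      apply intervalIntegral.norm_integral_le_of_norm_le ht.1
      · have := (ae_restrict_iff' measurableSet_Ioc).1 hl
        filter_upwards [this] with r hr hrt
        have hrT : r ∈ Icc 0 T := ⟨hrt.1.le, hrt.2.trans ht.2⟩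
        exact hr ⟨hrt.1, hrt.2.trans ht.2⟩ (x r) (y r)
          ((hRx r hrT).trans ((le_max_left _ _).trans (le_max_right _ _)))
          ((hRy r hrT).trans ((le_max_right _ _).trans (le_max_right _ _)))
      · apply ContinuousOn.intervalIntegrable
        rw [uIcc_of_le ht.1]
        exact (continuousOn_const.mul hu).mono (Icc_subset_Icc_right ht.2)) s hs
  rw [zero_mul] at this
  exact sub_eq_zero.1 (norm_le_zero_iff.1 this)

end aux

/-- If `f` takes the same value at `a ≠ b` and is monotone, then its derivative at `a` is `0`. -/
lemma aux_deriv {f : ℝ → ℝ} {T a b : ℝ} (hf : MonotoneOn f (Icc 0 T)) (ha : a ∈ Icc 0 T)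
    (hb : b ∈ Icc 0 T) (hab : b ≠ a) (h : f b = f a) : deriv f a = 0 := by
  by_cases hd : DifferentiableAt ℝ f a
  · have hconst : ∀ t ∈ uIcc a b, f t = f a := by
      intro t ht
      have htT : t ∈ Icc 0 T := (ordConnected_Icc.uIcc_subset ha hb) ht
      rcases le_total a b with hle | hle
      · rw [uIcc_of_le hle] at ht
        exact le_antisymm ((hf htT hb ht.2).trans h.le) (hf ha htT ht.1)
      · rw [uIcc_of_ge hle] at ht
        exact le_antisymm (hf htT ha ht.2) (h.ge.trans (hf hb htT ht.1))
    have h1 : HasDerivWithinAt f (deriv f a) (uIcc a b) a := hd.hasDerivAt.hasDerivWithinAt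
    have h2 : HasDerivWithinAt f 0 (uIcc a b) a :=
      (hasDerivWithinAt_const a (uIcc a b) (f a)).congr hconst rfl
    have hu : UniqueDiffWithinAt ℝ (uIcc a b) a :=
      uniqueDiffOn_Icc (by simpa using hab) a left_mem_uIcc
    exact hu.eq_deriv _ h1 h2
  · exact deriv_zero_of_not_differentiableAt hd

/-- Composition of a function continuous on a closed set with an a.e. measurable map. -/
lemma aux_comp {X Y : Type*} [TopologicalSpace X] [MeasurableSpace X] [BorelSpace X]
    [NormedAddCommGroup Y] [SecondCountableTopology Y]
    {h : X → Y} {K : Set X} (hK : IsClosed K) (hh : ContinuousOn h K)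
    {μ : Measure ℝ} {p : ℝ → X} (hp : AEMeasurable p μ) (hpK : ∀ᵐ r ∂μ, p r ∈ K) :
    AEStronglyMeasurable (fun r => h (p r)) μ := by
  classical
  borelize Y
  have h1 : Measurable (K.piecewise h (fun _ => 0)) :=
    hh.measurable_piecewise continuousOn_const hK.measurableSet
  refine (h1.comp_aemeasurable hp).aestronglyMeasurable.congr ?_
  filter_upwards [hpK] with r hr
  simp [Function.comp, piecewise_eq_of_mem _ _ _ hr]

/-- Proposition (first part of Prop. 2.2 of the paper): the space-time solution does not
change if `ψ` is replaced by `v ∘ φ₀`, where `v := ψ ∘ σ` and `σ` is any increasing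
right inverse of `φ₀`. -/
theorem stmt3 {n m q : ℕ}
    (U : Set (EuclideanSpace ℝ (Fin m))) (V : Set (EuclideanSpace ℝ (Fin q)))
    (g0 : EuclideanSpace ℝ (Fin n) → EuclideanSpace ℝ (Fin m) → EuclideanSpace ℝ (Fin q) →
      EuclideanSpace ℝ (Fin n))
    (g : Fin m → EuclideanSpace ℝ (Fin n) → EuclideanSpace ℝ (Fin m) →
      EuclideanSpace ℝ (Fin n))
    (M : ℝ) (hst : StandingHyp U V g0 g M)
    (x0 : EuclideanSpace ℝ (Fin n)) (St Tt : ℝ) (hSt : 0 < St) (hTt : 0 < Tt)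
    (phi0 : ℝ → ℝ) (phi : ℝ → EuclideanSpace ℝ (Fin m)) (psi : ℝ → EuclideanSpace ℝ (Fin q))
    -- (φ₀,φ) 1-Lipschitz, φ₀ nondecreasing, φ₀(0)=0
    (hlip : ∀ s1 ∈ Icc (0:ℝ) St, ∀ s2 ∈ Icc (0:ℝ) St,
      |phi0 s1 - phi0 s2| + ‖phi s1 - phi s2‖ ≤ |s1 - s2|)
    (hmono : MonotoneOn phi0 (Icc 0 St)) (h00 : phi0 0 = 0)
    -- φ₀' + |φ'| = 1 a.e.
    (hae : ∀ᵐ s ∂volume, s ∈ Ioo (0:ℝ) St → deriv phi0 s + ‖deriv phi s‖ = 1)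
    (hphiU : ∀ s ∈ Icc (0:ℝ) St, phi s ∈ U)
    (hphi0range : ∀ s ∈ Icc (0:ℝ) St, phi0 s ∈ Icc (0:ℝ) Tt)
    -- ψ Borel measurable with values in V
    (hpsim : Measurable psi) (hpsiV : ∀ s ∈ Icc (0:ℝ) St, psi s ∈ V)
    -- the increasing map σ : [0,T̃] → [0,S̃] with φ₀ ∘ σ = id, σ(0)=0, σ(T̃)=S̃
    (sig : ℝ → ℝ) (hsigmono : MonotoneOn sig (Icc 0 Tt))
    (hsigrange : ∀ t ∈ Icc (0:ℝ) Tt, sig t ∈ Icc (0:ℝ) St)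
    (hsiginv : ∀ t ∈ Icc (0:ℝ) Tt, phi0 (sig t) = t)
    (hsig0 : sig 0 = 0) (hsigT : sig Tt = St)
    -- ξ and ξ̃ : the space-time solutions for (φ₀,φ,ψ) and (φ₀,φ,(ψ∘σ)∘φ₀)
    (xi xi' : ℝ → EuclideanSpace ℝ (Fin n))
    (hxi : IsSTSol g0 g x0 phi0 phi psi xi (Icc 0 St))
    (hxi' : IsSTSol g0 g x0 phi0 phi (fun s => psi (sig (phi0 s))) xi' (Icc 0 St)) :
    ∀ s ∈ Icc (0:ℝ) St, xi s = xi' s := by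
  obtain ⟨hUc, hVc, hg0c, hg0l, hgl, hM, hgrow⟩ := hst
  have hSt0 := hSt.le
  set F : EuclideanSpace ℝ (Fin n) → ℝ → EuclideanSpace ℝ (Fin n) := fun x r =>
    (deriv phi0 r) • g0 x (phi r) (psi r) + ∑ i, ((deriv phi r) i) • g i x (phi r) with hF
  have hl0 : LipschitzOnWith 1 phi0 (Icc 0 St) := by
    refine LipschitzOnWith.of_dist_le_mul fun a ha b hb => ?_
    have := hlip a ha b hb
    have h2 := norm_nonneg (phi a - phi b)
    rw [Real.dist_eq, Real.dist_eq]; simp; linarith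
  have hl1 : LipschitzOnWith 1 phi (Icc 0 St) := by
    refine LipschitzOnWith.of_dist_le_mul fun a ha b hb => ?_
    have := hlip a ha b hb
    have h2 := abs_nonneg (phi0 a - phi0 b)
    rw [dist_eq_norm, Real.dist_eq]; simp; linarith
  have hd0 : ∀ r ∈ Ioo 0 St, |deriv phi0 r| ≤ 1 := fun r hr => by
    simpa using norm_deriv_le_of_lipschitzOn (Icc_mem_nhds hr.1 hr.2) hl0
  have hd1 : ∀ r ∈ Ioo 0 St, ∀ i, |(deriv phi r) i| ≤ 1 := fun r hr i => by
    have h1 : ‖deriv phi r‖ ≤ 1 := by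
      simpa using norm_deriv_le_of_lipschitzOn (Icc_mem_nhds hr.1 hr.2) hl1
    exact (PiLp.norm_apply_le (deriv phi r) i).trans h1
  have haeIoo : ∀ᵐ r ∂(volume.restrict (Ioc 0 St)), r ∈ Ioo 0 St := by
    rw [← restrict_Ioo_eq_restrict_Ioc]
    exact ae_restrict_mem measurableSet_Ioo
  -- the second solution solves the same equation
  have hx' : ∀ s ∈ Icc 0 St, xi' s = x0 + ∫ r in (0:ℝ)..s, F (xi' r) r := by
    intro s hs
    rw [hxi' s hs]
    congr 1
    apply intervalIntegral.integral_congr_ae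
    have := (ae_restrict_iff' measurableSet_Ioc).1 haeIoo
    filter_upwards [this] with r hr hrs
    rw [uIoc_of_le hs.1] at hrs
    have hrI := hr ⟨hrs.1, hrs.2.trans hs.2⟩
    have hrc := Ioo_subset_Icc_self hrI
    simp only [hF]
    by_cases he : sig (phi0 r) = r
    · rw [he]
    · have hz : deriv phi0 r = 0 :=
        aux_deriv hmono hrc (hsigrange _ (hphi0range r hrc)) he
          (hsiginv _ (hphi0range r hrc))
      rw [hz, zero_smul, zero_smul]
  obtain ⟨Ru, hRu⟩ := hUc.isBounded.exists_norm_le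
  have hRu0 : 0 ≤ Ru := (norm_nonneg _).trans (hRu _ (hphiU 0 ⟨le_rfl, hSt0⟩))
  have hgb : ∀ x, ∀ u ∈ U, ∀ v ∈ V, ‖g0 x u v‖ ≤ M * (1 + Ru) * (1 + ‖x‖) ∧
      ∀ i, ‖g i x u‖ ≤ M * (1 + Ru) * (1 + ‖x‖) := by
    intro x u hu v hv
    have h1 := hgrow x u hu v hv
    have h2 : Real.sqrt (‖x‖ ^ 2 + ‖u‖ ^ 2) ≤ ‖x‖ + Ru := by
      apply Real.sqrt_le_iff.2
      have := hRu u hu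
      have := norm_nonneg x
      have := norm_nonneg u
      constructor
      · positivity
      · nlinarith
    have h3 : M * (1 + Real.sqrt (‖x‖ ^ 2 + ‖u‖ ^ 2)) ≤ M * (1 + Ru) * (1 + ‖x‖) := by
      rw [mul_assoc]
      apply mul_le_mul_of_nonneg_left _ hM.le
      have := mul_nonneg hRu0 (norm_nonneg x)
      nlinarith
    have h4 := h1.trans h3
    have hsum : 0 ≤ ∑ i, ‖g i x u‖ ^ 2 := Finset.sum_nonneg fun i _ => sq_nonneg _
    constructor
    · exact (Real.le_sqrt_of_sq_le (by linarith)).trans h4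
    · intro i
      have : ‖g i x u‖ ^ 2 ≤ ∑ i, ‖g i x u‖ ^ 2 :=
        Finset.single_le_sum (f := fun i => ‖g i x u‖ ^ 2) (fun i _ => sq_nonneg _)
          (Finset.mem_univ i)
      exact (Real.le_sqrt_of_sq_le (by nlinarith [sq_nonneg ‖g0 x u v‖])).trans h4
  have hgc : ∀ i, ContinuousOn (fun p : EuclideanSpace ℝ (Fin n) × EuclideanSpace ℝ (Fin m) =>
      g i p.1 p.2) (univ ×ˢ U) := by
    intro i p hp
    obtain ⟨L, hL, hl⟩ := hgl i (‖p.1‖ + 1) (by positivity)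
    have ht : Tendsto (fun z : EuclideanSpace ℝ (Fin n) × EuclideanSpace ℝ (Fin m) =>
        L * (‖z.1 - p.1‖ + ‖z.2 - p.2‖)) (𝓝[univ ×ˢ U] p) (𝓝 0) := by
      have hc : Continuous (fun z : EuclideanSpace ℝ (Fin n) × EuclideanSpace ℝ (Fin m) =>
        L * (‖z.1 - p.1‖ + ‖z.2 - p.2‖)) := by fun_prop
      have := hc.tendsto p
      simp only [sub_self, norm_zero, add_zero, mul_zero] at this
      exact this.mono_left nhdsWithin_le_nhds
    rw [ContinuousWithinAt, tendsto_iff_norm_sub_tendsto_zero]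
    refine squeeze_zero' (Eventually.of_forall fun _ => norm_nonneg _) ?_ ht
    have hnear : ∀ᶠ z in 𝓝[univ ×ˢ U] p, ‖z.1‖ < ‖p.1‖ + 1 := by
      apply mem_nhdsWithin_of_mem_nhds
      have hc : Continuous (fun z : EuclideanSpace ℝ (Fin n) × EuclideanSpace ℝ (Fin m) =>
        ‖z.1‖) := by fun_prop
      exact hc.continuousAt.eventually_lt continuousAt_const (by linarith)
    filter_upwards [hnear, self_mem_nhdsWithin] with z hz hzU
    exact hl z.1 p.1 z.2 hzU.2 p.2 hp.2 hz.le (by linarith)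
  have hphim : AEMeasurable phi (volume.restrict (Ioc 0 St)) :=
    ((hl1.continuousOn.mono Ioc_subset_Icc_self).aestronglyMeasurable
      measurableSet_Ioc).aemeasurable
  have hcard : (0:ℝ) ≤ m := Nat.cast_nonneg m
  have hC : 0 ≤ (1 + (m:ℝ)) * (M * (1 + Ru)) := by positivity
  refine aux_unique (C := (1 + (m:ℝ)) * (M * (1 + Ru))) hSt0 hC F ?_ ?_ ?_ x0 xi xi' hxi hx'
  · intro x hxm
    have hIcc : ∀ᵐ r ∂(volume.restrict (Ioc 0 St)), r ∈ Icc 0 St := by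
      filter_upwards [haeIoo] with r hr using Ioo_subset_Icc_self hr
    refine AEStronglyMeasurable.add ?_ ?_
    · refine (stronglyMeasurable_deriv phi0).aestronglyMeasurable.smul ?_
      refine aux_comp ((isClosed_univ.prod hUc.isClosed).prod hVc.isClosed) hg0c
        (p := fun r => ((x r, phi r), psi r))
        ((hxm.aemeasurable.prodMk hphim).prodMk hpsim.aemeasurable) ?_
      filter_upwards [hIcc] with r hr
      exact ⟨⟨mem_univ _, hphiU r hr⟩, hpsiV r hr⟩
    · refine Finset.aestronglyMeasurable_fun_sum _ fun i _ => ?_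
      suffices h : AEStronglyMeasurable (fun r => (deriv phi r) i) (volume.restrict (Ioc 0 St)) ∧
          AEStronglyMeasurable (fun r => g i (x r) (phi r)) (volume.restrict (Ioc 0 St)) from
        h.1.smul h.2
      constructor
      · have hdm : Measurable (fun r => (deriv phi r) i) :=
          (by fun_prop : Continuous (fun z : EuclideanSpace ℝ (Fin m) => z i)).measurable.comp
            (measurable_deriv phi)
        exact hdm.aestronglyMeasurable
      · refine aux_comp (isClosed_univ.prod hUc.isClosed) (hgc i)
          (p := fun r => (x r, phi r)) (hxm.aemeasurable.prodMk hphim) ?_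
        filter_upwards [hIcc] with r hr
        exact ⟨mem_univ _, hphiU r hr⟩
  · filter_upwards [haeIoo] with r hr x
    have hrc := Ioo_subset_Icc_self hr
    obtain ⟨hb0, hb1⟩ := hgb x (phi r) (hphiU r hrc) (psi r) (hpsiV r hrc)
    have e0 : ‖deriv phi0 r • g0 x (phi r) (psi r)‖ ≤ M * (1 + Ru) * (1 + ‖x‖) := by
      rw [norm_smul]
      exact (mul_le_of_le_one_left (norm_nonneg _) (hd0 r hr)).trans hb0
    have e1 : ‖∑ i, (deriv phi r) i • g i x (phi r)‖ ≤ m * (M * (1 + Ru) * (1 + ‖x‖)) := by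
      refine (norm_sum_le_of_le (f := fun i => (deriv phi r) i • g i x (phi r)) Finset.univ
        (n := fun _ => M * (1 + Ru) * (1 + ‖x‖)) fun i _ => ?_).trans (by simp)
      rw [norm_smul]
      exact (mul_le_of_le_one_left (norm_nonneg _) (hd1 r hr i)).trans (hb1 i)
    refine (norm_add_le _ _).trans ((add_le_add e0 e1).trans (le_of_eq (by ring)))
  · intro R hR
    obtain ⟨L0, hL0, hl0'⟩ := hg0l R hR
    choose L hL hl using fun i => hgl i R hR
    refine ⟨L0 + ∑ i, L i, add_nonneg hL0 (Finset.sum_nonneg fun i _ => hL i), ?_⟩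
    filter_upwards [haeIoo] with r hr x1 x2 h1 h2
    have hrc := Ioo_subset_Icc_self hr
    have hU := hphiU r hrc
    have heq : F x1 r - F x2 r = deriv phi0 r • (g0 x1 (phi r) (psi r) - g0 x2 (phi r) (psi r)) +
        ∑ i, (deriv phi r) i • (g i x1 (phi r) - g i x2 (phi r)) := by
      simp only [hF, smul_sub, Finset.sum_sub_distrib]
      abel
    rw [heq, add_mul, Finset.sum_mul]
    refine (norm_add_le _ _).trans (add_le_add ?_ ?_)
    · rw [norm_smul]
      refine (mul_le_of_le_one_left (norm_nonneg _) (hd0 r hr)).trans ?_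
      simpa using hl0' (psi r) (hpsiV r hrc) x1 x2 (phi r) hU (phi r) hU h1 h2
    · refine norm_sum_le_of_le _ fun i _ => ?_
      rw [norm_smul]
      refine (mul_le_of_le_one_left (norm_nonneg _) (hd1 r hr i)).trans ?_
      simpa using hl i x1 x2 (phi r) hU (phi r) hU h1 h2

end
end

section
/- Let T > 0 and let σ : [0,T) → ℝ₊ be strictly increasing with σ(0)=0 and σ(t₂)−σ(t₁) > t₂−t₁ for all 0 ≤ t₁ < t₂ < T, and suppose S̄ := lim_{t→T⁻} σ(t) < +∞. Let φ₀ : ℝ₊ → [0,T] be the unique nondecreasing (hence 1-Lipschitz) map with φ₀(σ(t)) = t for all t ∈ [0,T) and φ₀(s) = T for all s ≥ S̄. Then there exists a sequence of absolutely continuous, strictly increasing maps σₕ : [0,T) → ℝ₊ with σₕ(0)=0, lim_{t→T} σₕ(t) = +∞, σₕ(t) → σ(t) for every t ∈ [0,T), whose inverses φ₀ₕ := σₕ⁻¹ : ℝ₊ → [0,T) are strictly increasing, 1-Lipschitz, surjective, converge locally uniformly to φ₀, and such that, setting tₕ := φ₀ₕ(S̄) and ε(h) := sup_{s∈[0,S̄]}|φ₀ₕ(s)−φ₀(s)|,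 one has sup_{s∈ℝ₊}|φ₀ₕ(s)−φ₀(s)| ≤ ε(h) + (T − tₕ), with tₕ < T for every h, tₕ → T and ε(h) → 0 as h → ∞. -/
open MeasureTheory Set Filter Topology
open scoped ENNReal

noncomputable section

/-- `f` is absolutely continuous on `[a,b]`: its (a.e. existing) derivative is integrable
and the fundamental theorem of calculus holds. -/
def ACOnI (f : ℝ → ℝ) (a b : ℝ) : Prop :=
  IntervalIntegrable (deriv f) volume a b ∧
    ∀ t ∈ Icc a b, f t = f a + ∫ s in a..t, deriv f s

lemma acOnI_of_abs {f : ℝ → ℝ} {a b : ℝ} (hf : AbsolutelyContinuousOnInterval f a b) :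
    ACOnI f a b := by
  refine ⟨hf.intervalIntegrable_deriv, fun t ht => ?_⟩
  have h2 : AbsolutelyContinuousOnInterval f a t := by
    apply hf.mono
    rw [uIcc_of_le ht.1, uIcc_of_le (ht.1.trans ht.2)]
    exact Icc_subset_Icc le_rfl ht.2
  rw [h2.integral_deriv_eq_sub]; ring

/-- Lipschitz interpolation of an expansive map at finitely many points. -/
lemma interp (T : ℝ) (sig : ℝ → ℝ)
    (hexp : ∀ t1 ∈ Ico (0:ℝ) T, ∀ t2 ∈ Ico (0:ℝ) T, t1 < t2 → t2 - t1 < sig t2 - sig t1)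
    (e : ℕ → ℝ) (he : ∀ i, e i ∈ Ico (0:ℝ) T) (n : ℕ) :
    ∃ f : ℝ → ℝ, (∃ K, LipschitzWith K f) ∧ (∀ x y, x ≤ y → y - x ≤ f y - f x) ∧
      ∀ i ≤ n, f (e i) = sig (e i) := by
  obtain ⟨L, hL0, hL⟩ : ∃ L : ℝ, 0 ≤ L ∧ ∀ i ≤ n, ∀ j ≤ n, e i < e j →
      (sig (e j) - e j) - (sig (e i) - e i) ≤ L * (e j - e i) := by
    let s := fun i j : ℕ => |((sig (e j) - e j) - (sig (e i) - e i)) / (e j - e i)|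
    refine ⟨∑ i ∈ Finset.range (n+1), ∑ j ∈ Finset.range (n+1), s i j,
      Finset.sum_nonneg fun i _ => Finset.sum_nonneg fun j _ => abs_nonneg _, ?_⟩
    intro i hi j hj hij
    have hpos : 0 < e j - e i := sub_pos.2 hij
    have h1 : s i j ≤ ∑ j ∈ Finset.range (n+1), s i j :=
      Finset.single_le_sum (f := fun j => s i j) (fun j _ => abs_nonneg _)
        (Finset.mem_range.2 (by omega))
    have h2 : ∑ j ∈ Finset.range (n+1), s i j ≤
        ∑ i ∈ Finset.range (n+1), ∑ j ∈ Finset.range (n+1), s i j :=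
      Finset.single_le_sum (f := fun i => ∑ j ∈ Finset.range (n+1), s i j)
        (fun i _ => Finset.sum_nonneg fun j _ => abs_nonneg _)
        (Finset.mem_range.2 (by omega))
    rw [← div_le_iff₀ hpos]
    exact (le_abs_self _).trans (h1.trans h2)
  have hne : (Finset.range (n+1)).Nonempty := ⟨0, by simp⟩
  let u : ℕ → ℝ → ℝ := fun i x => (sig (e i) - e i) + L * max (x - e i) 0
  let g : ℝ → ℝ := fun x => (Finset.range (n+1)).inf' hne (fun i => u i x)
  have gle : ∀ i ≤ n, ∀ x, g x ≤ u i x := fun i hi x =>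
    Finset.inf'_le (fun i => u i x) (Finset.mem_range.2 (by omega))
  have gex : ∀ x, ∃ i ≤ n, g x = u i x := fun x => by
    obtain ⟨i, hi, h⟩ := Finset.exists_mem_eq_inf' hne (fun i => u i x)
    exact ⟨i, by have := Finset.mem_range.1 hi; omega, h⟩
  have gmono : ∀ x y, x ≤ y → g x ≤ g y := by
    intro x y hxy
    obtain ⟨i, hi, h⟩ := gex y
    rw [h]
    refine (gle i hi x).trans ?_
    have : max (x - e i) 0 ≤ max (y - e i) 0 := max_le_max (by linarith) le_rfl
    have := mul_le_mul_of_nonneg_left this hL0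
    simp only [u]; linarith
  have glip : ∀ x y, x ≤ y → g y ≤ g x + L * (y - x) := by
    intro x y hxy
    obtain ⟨i, hi, h⟩ := gex x
    rw [h]
    refine (gle i hi y).trans ?_
    have : max (y - e i) 0 ≤ max (x - e i) 0 + (y - x) :=
      max_le (by linarith [le_max_left (x - e i) 0]) (by linarith [le_max_right (x - e i) 0])
    have := mul_le_mul_of_nonneg_left this hL0
    simp only [u]; linarith
  refine ⟨fun x => x + g x, ⟨Real.toNNReal (1 + L), LipschitzWith.of_dist_le_mul ?_⟩, ?_, ?_⟩
  · have key : ∀ x y, x ≤ y → |(x + g x) - (y + g y)| ≤ (1 + L) * |x - y| := by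
      intro x y hxy
      have h1 := gmono x y hxy
      have h2 := glip x y hxy
      rw [abs_of_nonpos (by linarith), abs_of_nonpos (by linarith)]
      linarith
    intro x y
    rw [Real.dist_eq, Real.dist_eq, Real.coe_toNNReal _ (by linarith)]
    rcases le_total x y with h | h
    · exact key x y h
    · rw [abs_sub_comm, abs_sub_comm x y]; exact key y x h
  · intro x y hxy
    have h1 := gmono x y hxy
    simp only; linarith
  · intro i hi
    have : g (e i) = sig (e i) - e i := by
      apply le_antisymm
      · simpa [u] using gle i hi (e i)
      · obtain ⟨j, hj, h⟩ := gex (e i)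
        rw [h]
        simp only [u]
        rcases lt_trichotomy (e j) (e i) with hji | hji | hji
        · rw [max_eq_left (by linarith)]
          linarith [hL j hj i hi hji]
        · simp [hji]
        · rw [max_eq_right (by linarith)]
          linarith [hexp _ (he i) _ (he j) hji]
    simp only [this]; ring

/-- Pointwise approximation. -/
lemma approx (T : ℝ) (hT : 0 < T) (sig : ℝ → ℝ)
    (hexp : ∀ t1 ∈ Ico (0:ℝ) T, ∀ t2 ∈ Ico (0:ℝ) T, t1 < t2 → t2 - t1 < sig t2 - sig t1) :
    ∃ f : ℕ → ℝ → ℝ, (∀ n, ∃ K, LipschitzWith K (f n)) ∧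
      (∀ n x y, x ≤ y → y - x ≤ f n y - f n x) ∧ (∀ n, f n 0 = sig 0) ∧
      ∀ t ∈ Ico (0:ℝ) T, Tendsto (fun n => f n t) atTop (𝓝 (sig t)) := by
  have hmono : MonotoneOn sig (Ico 0 T) := by
    intro x hx y hy hxy
    rcases hxy.eq_or_lt with rfl | h
    · rfl
    · linarith [hexp x hx y hy h]
  let D : Set ℝ := {x ∈ Ico 0 T | ¬ ContinuousWithinAt sig (Ico 0 T) x} ∪
    ((range ((↑) : ℚ → ℝ)) ∩ Ico 0 T)
  have hDc : D.Countable := hmono.countable_not_continuousWithinAt.union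
    ((countable_range _).mono inter_subset_left)
  have h0D : (0:ℝ) ∈ D := Or.inr ⟨⟨0, by simp⟩, le_rfl, hT⟩
  have hDsub : D ⊆ Ico 0 T := by
    rintro x (h | h)
    · exact h.1
    · exact h.2
  obtain ⟨d, hd⟩ := hDc.exists_eq_range ⟨0, h0D⟩
  let e : ℕ → ℝ := fun n => Nat.casesOn n 0 d
  have heD : ∀ i, e i ∈ D := by
    intro i
    cases i with
    | zero => exact h0D
    | succ k => rw [hd]; exact ⟨k, rfl⟩
  choose f hf1 hf2 hf3 using fun n => interp T sig hexp e (fun i => hDsub (heD i)) n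
  have hev : ∀ x ∈ D, ∀ᶠ n in atTop, f n x = sig x := by
    intro x hx
    rw [hd] at hx
    obtain ⟨k, rfl⟩ := hx
    filter_upwards [eventually_ge_atTop (k+1)] with n hn
    exact hf3 n (k+1) hn
  refine ⟨f, hf1, hf2, fun n => hf3 n 0 (Nat.zero_le _), ?_⟩
  intro t ht
  by_cases htD : t ∈ D
  · exact tendsto_const_nhds.congr' ((hev t htD).mono fun n hn => hn.symm)
  have hc : ContinuousWithinAt sig (Ico 0 T) t := by
    by_contra h
    exact htD (Or.inl ⟨ht, h⟩)
  have ht0 : 0 < t := lt_of_le_of_ne ht.1 (fun h => htD (h ▸ h0D))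
  have hc' : ContinuousAt sig t := hc.continuousAt (Ico_mem_nhds ht0 ht.2)
  rw [Metric.tendsto_atTop']
  intro ε hε
  obtain ⟨δ, hδ, hball⟩ := Metric.continuousAt_iff.1 hc' ε hε
  obtain ⟨q, hq1, hq2⟩ := exists_rat_btwn (show max 0 (t - δ) < t from max_lt ht0 (by linarith))
  obtain ⟨r, hr1, hr2⟩ := exists_rat_btwn (show t < min T (t + δ) from lt_min ht.2 (by linarith))
  have hq0 := max_lt_iff.1 hq1
  have hr0 := lt_min_iff.1 hr2
  have hqD : (q:ℝ) ∈ D := Or.inr ⟨⟨q, rfl⟩, hq0.1.le, hq2.trans ht.2⟩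
  have hrD : (r:ℝ) ∈ D := Or.inr ⟨⟨r, rfl⟩, (ht0.trans hr1).le, hr0.1⟩
  have hq3 := hball (x := q) (by rw [Real.dist_eq, abs_lt]; constructor <;> linarith)
  have hr3 := hball (x := r) (by rw [Real.dist_eq, abs_lt]; constructor <;> linarith)
  rw [Real.dist_eq, abs_lt] at hq3 hr3
  obtain ⟨N, hN⟩ := eventually_atTop.1 ((hev _ hqD).and (hev _ hrD))
  refine ⟨N, fun n hn => ?_⟩
  obtain ⟨e1, e2⟩ := hN n hn.le
  have h1 := hf2 n q t hq2.le
  have h2 := hf2 n t r hr1.le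
  rw [Real.dist_eq, abs_lt]
  constructor <;> linarith

/-- Inverse of a continuous expansive map blowing up at `T`. -/
lemma inverse (T : ℝ) (hT : 0 < T) (s : ℝ → ℝ) (h0 : s 0 = 0)
    (hexp : ∀ x ∈ Ico (0:ℝ) T, ∀ y ∈ Ico (0:ℝ) T, x ≤ y → y - x ≤ s y - s x)
    (hc : ContinuousOn s (Ico 0 T)) (hlim : Tendsto s (𝓝[<] T) atTop) :
    ∃ p : ℝ → ℝ, StrictMonoOn p (Ici 0) ∧ LipschitzOnWith 1 p (Ici 0) ∧
      p '' Ici 0 = Ico 0 T ∧ (∀ t ∈ Ico (0:ℝ) T, p (s t) = t) ∧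
      (∀ r ∈ Ici (0:ℝ), s (p r) = r) ∧ (∀ r ∈ Ici (0:ℝ), p r ∈ Ico (0:ℝ) T) := by
  have hsm : StrictMonoOn s (Ico 0 T) := by
    intro x hx y hy hxy
    linarith [hexp x hx y hy hxy.le]
  have hsurj : ∀ r : ℝ, 0 ≤ r → ∃ t ∈ Ico (0:ℝ) T, s t = r := by
    intro r hr
    obtain ⟨b, hb1, hb2⟩ := ((hlim.eventually_ge_atTop r).and
      (Ico_mem_nhdsLT hT)).exists
    have hsub : Icc 0 b ⊆ Ico 0 T := fun x hx => ⟨hx.1, hx.2.trans_lt hb2.2⟩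
    obtain ⟨t, ht, h⟩ := intermediate_value_Icc hb2.1 (hc.mono hsub) (show r ∈ Icc (s 0) (s b) from
      ⟨by rw [h0]; exact hr, hb1⟩)
    exact ⟨t, hsub ht, h⟩
  choose! p hp1 hp2 using hsurj
  have hs0 : ∀ t ∈ Ico (0:ℝ) T, 0 ≤ s t := by
    intro t ht
    have := hexp 0 ⟨le_rfl, hT⟩ t ht ht.1
    linarith [ht.1]
  have hinv : ∀ t ∈ Ico (0:ℝ) T, p (s t) = t := fun t ht =>
    hsm.injOn (hp1 _ (hs0 t ht)) ht (hp2 _ (hs0 t ht))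
  have hpm : StrictMonoOn p (Ici 0) := by
    intro x hx y hy hxy
    rw [← hsm.lt_iff_lt (hp1 x hx) (hp1 y hy), hp2 x hx, hp2 y hy]
    exact hxy
  refine ⟨p, hpm, ?_, ?_, hinv, hp2, hp1⟩
  · have key : ∀ x ∈ Ici (0:ℝ), ∀ y ∈ Ici (0:ℝ), x ≤ y → |p x - p y| ≤ |x - y| := by
      intro x hx y hy hxy
      have h1 := hpm.monotoneOn hx hy hxy
      have h2 := hexp _ (hp1 x hx) _ (hp1 y hy) h1
      rw [hp2 x hx, hp2 y hy] at h2
      rw [abs_of_nonpos (by linarith), abs_of_nonpos (by linarith)]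
      linarith
    apply LipschitzOnWith.of_dist_le_mul
    intro x hx y hy
    rw [Real.dist_eq, Real.dist_eq, NNReal.coe_one, one_mul]
    rcases le_total x y with h | h
    · exact key x hx y hy h
    · rw [abs_sub_comm, abs_sub_comm x y]; exact key y hy x hx h
  · ext t
    constructor
    · rintro ⟨r, hr, rfl⟩; exact hp1 r hr
    · intro ht; exact ⟨s t, hs0 t ht, hinv t ht⟩

/-- The clocks. -/
lemma clocks (T : ℝ) (hT : 0 < T) (sig : ℝ → ℝ) (hsig0 : sig 0 = 0)
    (hexp : ∀ t1 ∈ Ico (0:ℝ) T, ∀ t2 ∈ Ico (0:ℝ) T, t1 < t2 → t2 - t1 < sig t2 - sig t1) :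
    ∃ s : ℕ → ℝ → ℝ, (∀ n, s n 0 = 0) ∧
      (∀ n, ∀ x ∈ Ico (0:ℝ) T, ∀ y ∈ Ico (0:ℝ) T, x ≤ y → y - x ≤ s n y - s n x) ∧
      (∀ n, ContinuousOn (s n) (Ico 0 T)) ∧
      (∀ n, ∀ t ∈ Ico (0:ℝ) T, ACOnI (s n) 0 t) ∧
      (∀ n, Tendsto (s n) (𝓝[<] T) atTop) ∧
      (∀ t ∈ Ico (0:ℝ) T, Tendsto (fun n => s n t) atTop (𝓝 (sig t))) := by
  obtain ⟨f, hf1, hf2, hf3, hf4⟩ := approx T hT sig hexp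
  let b : ℝ → ℝ := fun t => (T - t)⁻¹ - T⁻¹
  let c : ℕ → ℝ := fun n => 1 / ((n:ℝ) + 1)
  have hcpos : ∀ n, 0 < c n := fun n => Nat.one_div_pos_of_nat
  have hbc : ContinuousOn b (Ico 0 T) := by
    apply ContinuousOn.sub _ continuousOn_const
    apply ContinuousOn.inv₀ (by fun_prop)
    intro x hx
    have h : 0 < T - x := sub_pos.2 hx.2
    exact h.ne'
  have hblim : Tendsto b (𝓝[<] T) atTop := by
    apply tendsto_atTop_add_const_right
    apply tendsto_inv_nhdsGT_zero.comp
    apply tendsto_nhdsWithin_of_tendsto_nhds_of_eventually_within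
    · have : Tendsto (fun t => T - t) (𝓝 T) (𝓝 (T - T)) := by
        apply Continuous.tendsto; fun_prop
      rw [sub_self] at this
      exact this.mono_left nhdsWithin_le_nhds
    · filter_upwards [self_mem_nhdsWithin] with x hx
      exact sub_pos.2 (mem_Iio.1 hx)
  have hbmono : ∀ x ∈ Ico (0:ℝ) T, ∀ y ∈ Ico (0:ℝ) T, x ≤ y → b x ≤ b y := by
    intro x hx y hy hxy
    have : (T - x)⁻¹ ≤ (T - y)⁻¹ := inv_anti₀ (by linarith [hy.2]) (by linarith)
    simp only [b]; linarith
  have hbac : ∀ t ∈ Ico (0:ℝ) T, AbsolutelyContinuousOnInterval b 0 t := by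
    intro t ht
    have hTt : 0 < T - t := by linarith [ht.2]
    apply LipschitzOnWith.absolutelyContinuousOnInterval (K := Real.toNNReal ((T - t)⁻¹ * (T-t)⁻¹))
    apply LipschitzOnWith.of_dist_le_mul
    rw [uIcc_of_le ht.1]
    intro x hx y hy
    have hx1 : T - t ≤ T - x := by linarith [hx.2]
    have hy1 : T - t ≤ T - y := by linarith [hy.2]
    have hx2 : 0 < T - x := by linarith
    have hy2 : 0 < T - y := by linarith
    rw [Real.dist_eq, Real.dist_eq, Real.coe_toNNReal _ (by positivity)]
    have : b x - b y = ((T - x)⁻¹ * (T - y)⁻¹) * (x - y) := by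
      simp only [b]; field_simp; ring
    rw [this, abs_mul, abs_of_pos (by positivity)]
    apply mul_le_mul_of_nonneg_right _ (abs_nonneg _)
    exact mul_le_mul (inv_anti₀ hTt hx1) (inv_anti₀ hTt hy1) (by positivity) (by positivity)
  refine ⟨fun n t => f n t + c n * b t, ?_, ?_, ?_, ?_, ?_, ?_⟩
  · intro n; simp [hf3, hsig0, b]
  · intro n x hx y hy hxy
    have h1 := hf2 n x y hxy
    have h2 := mul_le_mul_of_nonneg_left (hbmono x hx y hy hxy) (hcpos n).le
    simp only; linarith
  · intro n
    obtain ⟨K, hK⟩ := hf1 n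
    exact hK.continuous.continuousOn.add (continuousOn_const.mul hbc)
  · intro n t ht
    obtain ⟨K, hK⟩ := hf1 n
    exact acOnI_of_abs
      ((hK.lipschitzOnWith.absolutelyContinuousOnInterval).add ((hbac t ht).const_mul (c n)))
  · intro n
    apply tendsto_atTop_mono' _ _ (hblim.const_mul_atTop (hcpos n))
    filter_upwards [Ico_mem_nhdsLT hT] with x hx
    have := hf2 n 0 x hx.1
    rw [hf3, hsig0] at this
    linarith [hx.1]
  · intro t ht
    have : Tendsto (fun n => f n t + c n * b t) atTop (𝓝 (sig t + 0 * b t)) :=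
      (hf4 t ht).add (tendsto_one_div_add_atTop_nhds_zero_nat.mul_const _)
    simpa using this

/-- Theorem 5.2, Case 1 (`S̄ < ∞`): approximation of an expansive, strictly increasing
clock `σ` with bounded image by absolutely continuous, strictly increasing, surjective
clocks `σₕ`, with the stated properties of the inverses `φ₀ₕ`. -/
theorem stmt5 (T : ℝ) (hT : 0 < T)
    (sig : ℝ → ℝ) (hsig0 : sig 0 = 0)
    (hexp : ∀ t1 ∈ Ico (0:ℝ) T, ∀ t2 ∈ Ico (0:ℝ) T, t1 < t2 → t2 - t1 < sig t2 - sig t1)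
    (Sb : ℝ) (hSb : Tendsto sig (𝓝[<] T) (𝓝 Sb))
    (phi0 : ℝ → ℝ) (hphi0mono : MonotoneOn phi0 (Ici 0))
    (hphi0inv : ∀ t ∈ Ico (0:ℝ) T, phi0 (sig t) = t)
    (hphi0T : ∀ s, Sb ≤ s → phi0 s = T) :
    ∃ (sigh : ℕ → ℝ → ℝ) (phi0h : ℕ → ℝ → ℝ) (eps : ℕ → ℝ),
      -- σₕ(0)=0, σₕ strictly increasing and absolutely continuous on [0,t] for all t<T
      (∀ h, sigh h 0 = 0) ∧
      (∀ h, StrictMonoOn (sigh h) (Ico 0 T)) ∧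
      (∀ h, ∀ t ∈ Ico (0:ℝ) T, ACOnI (sigh h) 0 t) ∧
      -- lim_{t→T} σₕ(t) = +∞
      (∀ h, Tendsto (sigh h) (𝓝[<] T) atTop) ∧
      -- pointwise convergence σₕ → σ on [0,T)
      (∀ t ∈ Ico (0:ℝ) T, Tendsto (fun h => sigh h t) atTop (𝓝 (sig t))) ∧
      -- φ₀ₕ = σₕ⁻¹ : ℝ₊ → [0,T) strictly increasing, 1-Lipschitz, surjective
      (∀ h, StrictMonoOn (phi0h h) (Ici 0)) ∧
      (∀ h, LipschitzOnWith 1 (phi0h h) (Ici 0)) ∧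
      (∀ h, phi0h h '' Ici 0 = Ico 0 T) ∧
      (∀ h, ∀ t ∈ Ico (0:ℝ) T, phi0h h (sigh h t) = t) ∧
      (∀ h, ∀ s ∈ Ici (0:ℝ), sigh h (phi0h h s) = s) ∧
      -- locally uniform convergence φ₀ₕ → φ₀
      (∀ A : ℝ, TendstoUniformlyOn (fun h => phi0h h) phi0 atTop (Icc 0 A)) ∧
      -- tₕ := φ₀ₕ(S̄) < T, tₕ → T
      (∀ h, phi0h h Sb < T) ∧
      Tendsto (fun h => phi0h h Sb) atTop (𝓝 T) ∧
      -- ε(h) bounds |φ₀ₕ − φ₀| on [0,S̄] and ε(h) → 0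
      (∀ h, ∀ s ∈ Icc (0:ℝ) Sb, |phi0h h s - phi0 s| ≤ eps h) ∧
      Tendsto eps atTop (𝓝 0) ∧
      -- global bound: sup_{s≥0} |φ₀ₕ(s) − φ₀(s)| ≤ ε(h) + (T − tₕ)
      (∀ h, ∀ s ∈ Ici (0:ℝ), |phi0h h s - phi0 s| ≤ eps h + (T - phi0h h Sb)) := by
  obtain ⟨s, hs0, hs1, hs2, hs3, hs4, hs5⟩ := clocks T hT sig hsig0 hexp
  choose p hp1 hp2 hp3 hp4 hp5 hp6 using
    fun n => inverse T hT (s n) (hs0 n) (hs1 n) (hs2 n) (hs4 n)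
  have hsm : ∀ n, StrictMonoOn (s n) (Ico 0 T) := by
    intro n x hx y hy hxy
    linarith [hs1 n x hx y hy hxy.le]
  have hmono : MonotoneOn sig (Ico 0 T) := by
    intro x hx y hy hxy
    rcases hxy.eq_or_lt with rfl | h
    · rfl
    · linarith [hexp x hx y hy h]
  have hsn : ∀ t ∈ Ico (0:ℝ) T, 0 ≤ sig t := fun t ht => by
    have := hmono ⟨le_rfl, hT⟩ ht ht.1
    rwa [hsig0] at this
  have hleSb : ∀ t ∈ Ico (0:ℝ) T, sig t ≤ Sb := by
    intro t ht
    apply ge_of_tendsto hSb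
    filter_upwards [Ico_mem_nhdsLT ht.2] with x hx
    exact hmono ht ⟨ht.1.trans hx.1, hx.2⟩ hx.1
  have hSb0 : 0 ≤ Sb := by
    have := hleSb 0 ⟨le_rfl, hT⟩
    rwa [hsig0] at this
  have hphi_nonneg : ∀ r, 0 ≤ r → 0 ≤ phi0 r := by
    intro r hr
    have h := hphi0inv 0 ⟨le_rfl, hT⟩
    rw [hsig0] at h
    have := hphi0mono (mem_Ici.2 (le_refl (0:ℝ))) hr hr
    rwa [h] at this
  have hphi_le : ∀ r, 0 ≤ r → phi0 r ≤ T := by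
    intro r hr
    have := hphi0mono hr (show max r Sb ∈ Ici 0 from hr.trans (le_max_left _ _)) (le_max_left _ _)
    rwa [hphi0T _ (le_max_right _ _)] at this
  -- pointwise convergence of the inverses
  have hpt : ∀ r, 0 ≤ r → Tendsto (fun n => p n r) atTop (𝓝 (phi0 r)) := by
    intro r hr
    rw [tendsto_order]
    constructor
    · intro a ha
      by_cases ha0 : a < 0
      · exact Eventually.of_forall fun n => ha0.trans_le (hp6 n r hr).1
      push Not at ha0
      have haI : a ∈ Ico (0:ℝ) T := ⟨ha0, ha.trans_le (hphi_le r hr)⟩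
      have h1 : sig a < r := by
        by_contra! h
        have := hphi0mono hr (show sig a ∈ Ici 0 from hsn a haI) h
        rw [hphi0inv a haI] at this
        linarith
      filter_upwards [(hs5 a haI).eventually_lt_const h1] with n hn
      rw [← (hsm n).lt_iff_lt haI (hp6 n r hr), hp5 n r hr]
      exact hn
    · intro a ha
      by_cases haT : T ≤ a
      · exact Eventually.of_forall fun n => (hp6 n r hr).2.trans_le haT
      push Not at haT
      have haI : a ∈ Ico (0:ℝ) T := ⟨(hphi_nonneg r hr).trans ha.le, haT⟩
      have h1 : r < sig a := by
        by_contra! h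
        have := hphi0mono (show sig a ∈ Ici 0 from hsn a haI) hr h
        rw [hphi0inv a haI] at this
        linarith
      filter_upwards [(hs5 a haI).eventually_const_lt h1] with n hn
      rw [← (hsm n).lt_iff_lt (hp6 n r hr) haI, hp5 n r hr]
      exact hn
  have hlip : ∀ n, ∀ x ∈ Ici (0:ℝ), ∀ y ∈ Ici (0:ℝ), dist (p n x) (p n y) ≤ dist x y := by
    intro n x hx y hy
    simpa using (hp2 n).dist_le_mul x hx y hy
  have hlip0 : ∀ x ∈ Ici (0:ℝ), ∀ y ∈ Ici (0:ℝ), dist (phi0 x) (phi0 y) ≤ dist x y := by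
    intro x hx y hy
    exact le_of_tendsto' ((hpt x hx).dist (hpt y hy)) (fun n => hlip n x hx y hy)
  have hunif : ∀ A : ℝ, TendstoUniformlyOn (fun h => p h) phi0 atTop (Icc 0 A) := by
    intro A
    rw [← tendstoLocallyUniformlyOn_iff_tendstoUniformlyOn_of_compact isCompact_Icc,
      Metric.tendstoLocallyUniformlyOn_iff]
    intro ε hε
    intro x hx
    refine ⟨Metric.ball x (ε/3) ∩ Icc 0 A,
      inter_mem (mem_nhdsWithin_of_mem_nhds (Metric.ball_mem_nhds _ (by linarith)))
        self_mem_nhdsWithin, ?_⟩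
    filter_upwards [Metric.tendsto_nhds.1 (hpt x hx.1) (ε/3) (by linarith)] with n hn
    rintro y ⟨hy1, hy2⟩
    rw [Metric.mem_ball] at hy1
    have h1 := hlip0 y hy2.1 x hx.1
    have h2 := hlip n x hx.1 y hy2.1
    rw [dist_comm x y] at h2
    rw [dist_comm] at hn
    have := dist_triangle4 (phi0 y) (phi0 x) (p n x) (p n y)
    linarith
  let eps : ℕ → ℝ := fun n => sSup ((fun r => |p n r - phi0 r|) '' Icc 0 Sb)
  have hbdd : ∀ n, BddAbove ((fun r => |p n r - phi0 r|) '' Icc 0 Sb) := by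
    intro n
    refine ⟨T, ?_⟩
    rintro _ ⟨r, hr, rfl⟩
    have h1 := hp6 n r hr.1
    have h2 := hphi_nonneg r hr.1
    have h3 := hphi_le r hr.1
    simp only
    rw [abs_le]
    constructor <;> linarith [h1.1, h1.2]
  have heps : ∀ n, ∀ r ∈ Icc (0:ℝ) Sb, |p n r - phi0 r| ≤ eps n := fun n r hr =>
    le_csSup (hbdd n) ⟨r, hr, rfl⟩
  have heps0 : ∀ n, 0 ≤ eps n := fun n =>
    (abs_nonneg _).trans (heps n 0 ⟨le_rfl, hSb0⟩)
  refine ⟨s, p, eps, hs0, hsm, hs3, hs4, hs5, hp1, hp2, hp3, hp4, hp5, hunif,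
    fun n => (hp6 n Sb hSb0).2, ?_, heps, ?_, ?_⟩
  · have := hpt Sb hSb0
    rwa [hphi0T Sb le_rfl] at this
  · rw [Metric.tendsto_nhds]
    intro ε hε
    filter_upwards [Metric.tendstoUniformlyOn_iff.1 (hunif Sb) (ε/2) (by linarith)] with n hn
    rw [Real.dist_eq, sub_zero, abs_of_nonneg (heps0 n)]
    refine lt_of_le_of_lt (csSup_le ⟨_, 0, ⟨le_rfl, hSb0⟩, rfl⟩ ?_) (half_lt_self hε)
    rintro _ ⟨r, hr, rfl⟩
    have := hn r hr
    rw [dist_comm, Real.dist_eq] at this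
    exact this.le
  · intro n r hr
    have hSbT := (hp6 n Sb hSb0).2
    rcases le_total r Sb with h | h
    · linarith [heps n r ⟨hr, h⟩]
    · rw [hphi0T r h]
      have h1 := (hp1 n).monotoneOn (show Sb ∈ Ici 0 from hSb0) hr h
      have h2 := (hp6 n r hr).2
      rw [abs_of_nonpos (by linarith)]
      linarith [heps0 n]

end
end

section
/- Let T > 0 and let σ : [0,T) → ℝ₊ be strictly increasing with σ(0)=0, σ(t₂)−σ(t₁) > t₂−t₁ for all 0 ≤ t₁ < t₂ < T, and lim_{t→T⁻} σ(t) = +∞. Let φ₀ : ℝ₊ → [0,T) be the unique nondecreasing surjective map with φ₀(σ(t)) = t for all t ∈ [0,T). Then there exists a sequence of absolutely continuous, strictly increasing maps σₕ : [0,T) → ℝ₊ with σₕ(0)=0, lim_{t→T} σₕ(t) = +∞, σₕ(t) → σ(t) for every t ∈ [0,T), whose inverses φ₀ₕ := σₕ⁻¹ : ℝ₊ → [0,T) are strictly increasing, 1-Lipschitz, surjective, converge locally uniformly to φ₀, and such that for every S ∈ (0,∞), setting t := φ₀(S), tₕ := φ₀ₕ(S) and ε_S(h) := sup_{s∈[0,S]}|φ₀ₕ(s)−φ₀(s)|,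 one has sup_{s∈ℝ₊}|φ₀ₕ(s)−φ₀(s)| ≤ ε_S(h) + (T − min{t,tₕ}), with t, tₕ < T for every h, |tₕ − t| ≤ ε_S(h), and ε_S(h) → 0 as h → ∞. -/
open MeasureTheory Set Filter Topology
open scoped ENNReal

noncomputable section

lemma aux_slope (F : Finset ℝ) (g : ℝ → ℝ) :
    ∃ K : ℝ, 0 ≤ K ∧ ∀ x ∈ F, ∀ y ∈ F, x < y → g y - g x ≤ K * (y - x) := by
  refine ⟨∑ x ∈ F, ∑ y ∈ F, |(g y - g x) / (y - x)|, by positivity, ?_⟩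
  intro x hx y hy hxy
  have h1 : |(g y - g x) / (y - x)| ≤ ∑ y ∈ F, |(g y - g x) / (y - x)| :=
    Finset.single_le_sum (f := fun y => |(g y - g x) / (y - x)|)
      (fun i _ => abs_nonneg _) hy
  have h2 : ∑ y ∈ F, |(g y - g x) / (y - x)| ≤
      ∑ x ∈ F, ∑ y ∈ F, |(g y - g x) / (y - x)| :=
    Finset.single_le_sum (f := fun x => ∑ y ∈ F, |(g y - g x) / (y - x)|)
      (fun i _ => by positivity) hx
  have h3 := (le_abs_self _).trans (h1.trans h2)
  have h4 : 0 < y - x := by linarith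
  rwa [div_le_iff₀ h4] at h3

/-- Monotone Lipschitz interpolation of monotone data on a finite set. -/
lemma aux_interp (F : Finset ℝ) (hF : F.Nonempty) (g : ℝ → ℝ)
    (hg : MonotoneOn g (F : Set ℝ)) :
    ∃ (G : ℝ → ℝ) (K : ℝ), 0 ≤ K ∧ Monotone G ∧
      (∀ x y, x ≤ y → G y - G x ≤ K * (y - x)) ∧ ∀ x ∈ F, G x = g x := by
  obtain ⟨K, hK, hs⟩ := aux_slope F g
  refine ⟨fun t => F.inf' hF (fun x => g x + K * max (t - x) 0), K, hK, ?_, ?_, ?_⟩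
  · intro a b hab
    refine Finset.le_inf' _ _ fun x hx => (Finset.inf'_le _ hx).trans ?_
    gcongr
  · intro a b hab
    have : F.inf' hF (fun x => g x + K * max (b - x) 0) - K * (b - a) ≤
        F.inf' hF (fun x => g x + K * max (a - x) 0) := by
      refine Finset.le_inf' _ _ fun x hx => ?_
      have h1 := Finset.inf'_le (fun x => g x + K * max (b - x) 0) hx
      have h2 : max (b - x) 0 ≤ max (a - x) 0 + (b - a) := by
        rcases max_cases (b - x) 0 with h | h <;> rcases max_cases (a - x) 0 with h' | h' <;>
          linarith
      have h3 := mul_le_mul_of_nonneg_left h2 hK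
      linarith
    simp only
    linarith
  · intro y hy
    apply le_antisymm
    · refine (Finset.inf'_le _ hy).trans ?_
      simp
    · refine Finset.le_inf' _ _ fun x hx => ?_
      rcases le_or_gt y x with h | h
      · have := hg hy hx h
        have h2 : 0 ≤ K * max (y - x) 0 := by positivity
        linarith
      · have := hs x hx y hy h
        rw [max_eq_left (by linarith)]
        linarith

structure GoodClock (T : ℝ) (f : ℝ → ℝ) : Prop where
  zero : f 0 = 0
  expan : ∀ x y, 0 ≤ x → x ≤ y → y < T → y - x ≤ f y - f x
  lip : ∀ t, 0 ≤ t → t < T → ∃ C : ℝ, 0 ≤ C ∧ ∀ x y, 0 ≤ x → x ≤ y → y ≤ t →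
    f y - f x ≤ C * (y - x)
  lim : Tendsto f (𝓝[<] T) atTop

lemma GoodClock.lipOn {T : ℝ} {f : ℝ → ℝ} (hf : GoodClock T f) {t : ℝ} (h0 : 0 ≤ t)
    (ht : t < T) : ∃ C : NNReal, LipschitzOnWith C f (Icc 0 t) := by
  obtain ⟨C, hC, h⟩ := hf.lip t h0 ht
  refine ⟨⟨C, hC⟩, LipschitzOnWith.of_le_add_mul _ ?_⟩
  intro x hx y hy
  change f x ≤ f y + C * dist x y
  rcases le_total x y with hxy | hxy
  · have h1 := hf.expan x y hx.1 hxy (hy.2.trans_lt ht)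
    have h2 : 0 ≤ C * dist x y := by positivity
    linarith
  · have h1 := h y x hy.1 hxy hx.2
    rw [Real.dist_eq, abs_of_nonneg (by linarith)]
    linarith

lemma GoodClock.strictMono {T : ℝ} {f : ℝ → ℝ} (hf : GoodClock T f) :
    StrictMonoOn f (Ico 0 T) := by
  intro x hx y hy hxy
  have := hf.expan x y hx.1 hxy.le hy.2
  linarith

lemma GoodClock.ac {T : ℝ} {f : ℝ → ℝ} (hf : GoodClock T f) {t : ℝ} (ht : t ∈ Ico 0 T) :
    ACOnI f 0 t := by
  have key : ∀ u ∈ Icc 0 t, AbsolutelyContinuousOnInterval f 0 u := by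
    intro u hu
    obtain ⟨C, hC⟩ := hf.lipOn hu.1 (hu.2.trans_lt ht.2)
    rw [← uIcc_of_le hu.1] at hC
    exact hC.absolutelyContinuousOnInterval
  refine ⟨(key t ⟨ht.1, le_rfl⟩).intervalIntegrable_deriv, fun u hu => ?_⟩
  rw [(key u hu).integral_deriv_eq_sub]
  ring

lemma GoodClock.surj {T : ℝ} (hT : 0 < T) {f : ℝ → ℝ} (hf : GoodClock T f) {s : ℝ}
    (hs : 0 ≤ s) : ∃ t ∈ Ico 0 T, f t = s := by
  have h1 : ∀ᶠ t in 𝓝[<] T, t ∈ Ioo 0 T := Ioo_mem_nhdsLT hT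
  obtain ⟨b, hb, hb2⟩ := (h1.and (hf.lim.eventually_ge_atTop s)).exists
  obtain ⟨C, hC⟩ := hf.lipOn hb.1.le hb.2
  have := intermediate_value_Icc hb.1.le hC.continuousOn
  obtain ⟨t, ht, h⟩ := this (show s ∈ Icc (f 0) (f b) by rw [hf.zero]; exact ⟨hs, hb2⟩)
  exact ⟨t, ⟨ht.1, ht.2.trans_lt hb.2⟩, h⟩

lemma GoodClock.inv {T : ℝ} (hT : 0 < T) {f : ℝ → ℝ} (hf : GoodClock T f) :
    ∃ p : ℝ → ℝ, StrictMonoOn p (Ici 0) ∧ LipschitzOnWith 1 p (Ici 0) ∧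
      p '' Ici 0 = Ico 0 T ∧ (∀ t ∈ Ico (0:ℝ) T, p (f t) = t) ∧
      ∀ s ∈ Ici (0:ℝ), f (p s) = s := by
  have : ∀ s : ℝ, ∃ t, 0 ≤ s → t ∈ Ico 0 T ∧ f t = s := by
    intro s
    by_cases hs : 0 ≤ s
    · obtain ⟨t, h⟩ := hf.surj hT hs
      exact ⟨t, fun _ => h⟩
    · exact ⟨0, fun h => absurd h hs⟩
  choose p hp using this
  have hsm : StrictMonoOn p (Ici 0) := by
    intro x hx y hy hxy
    rw [← hf.strictMono.lt_iff_lt (hp x hx).1 (hp y hy).1, (hp x hx).2, (hp y hy).2]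
    exact hxy
  have hnn : ∀ t ∈ Ico (0:ℝ) T, 0 ≤ f t := by
    intro t ht
    have := hf.expan 0 t le_rfl ht.1 ht.2
    rw [hf.zero] at this
    linarith [ht.1]
  have hinv : ∀ t ∈ Ico (0:ℝ) T, p (f t) = t := by
    intro t ht
    exact hf.strictMono.injOn (hp _ (hnn t ht)).1 ht (hp _ (hnn t ht)).2
  refine ⟨p, hsm, ?_, ?_, hinv, fun s hs => (hp s hs).2⟩
  · refine LipschitzOnWith.of_le_add_mul _ ?_
    intro x hx y hy
    rw [NNReal.coe_one, one_mul]
    rcases le_total x y with hxy | hxy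
    · have := hsm.monotoneOn hx hy hxy
      have h2 : 0 ≤ dist x y := by positivity
      linarith
    · have h1 := hf.expan _ _ (hp y hy).1.1 (hsm.monotoneOn hy hx hxy) (hp x hx).1.2
      rw [(hp x hx).2, (hp y hy).2] at h1
      rw [Real.dist_eq, abs_of_nonneg (by linarith)]
      linarith
  · apply Subset.antisymm
    · rintro _ ⟨s, hs, rfl⟩
      exact (hp s hs).1
    · intro t ht
      exact ⟨f t, hnn t ht, hinv t ht⟩

lemma aux_clock {T : ℝ} (hT : 0 < T) (G : ℝ → ℝ) (K : ℝ) (hK : 0 ≤ K) (hG0 : G 0 = 0)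
    (hG : Monotone G) (hL : ∀ x y, x ≤ y → G y - G x ≤ K * (y - x)) (h : ℕ) :
    GoodClock T (fun t => t + G t + max 0 ((T - t)⁻¹ - (h + 1) / T)) := by
  have hinv : ∀ x y, x ≤ y → y < T → (T - x)⁻¹ ≤ (T - y)⁻¹ := by
    intro x y hxy hy
    apply inv_anti₀ <;> linarith
  refine ⟨?_, ?_, ?_, ?_⟩
  · have : (T - 0)⁻¹ - (h + 1) / T ≤ 0 := by
      rw [sub_zero, inv_eq_one_div, ← sub_div]
      apply div_nonpos_of_nonpos_of_nonneg _ hT.le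
      have : (0:ℝ) ≤ h := by positivity
      linarith
    simp only [hG0, max_eq_left this]
    simp
  · intro x y hx hxy hy
    have h1 := hG hxy
    have h2 := max_le_max_left 0 (sub_le_sub_right (hinv x y hxy hy) ((h + 1) / T))
    linarith
  · intro t h0 ht
    have hd : 0 < T - t := by linarith
    refine ⟨1 + K + (T - t)⁻¹ * (T - t)⁻¹, by positivity, ?_⟩
    intro x y hx hxy hy
    have h1 := hL x y hxy
    have e : (T - y)⁻¹ - (T - x)⁻¹ = (T - y)⁻¹ * (T - x)⁻¹ * (y - x) := by
      have : T - y ≠ 0 := by linarith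
      have : T - x ≠ 0 := by linarith
      field_simp
      ring
    have h2 : (T - y)⁻¹ * (T - x)⁻¹ * (y - x) ≤ (T - t)⁻¹ * (T - t)⁻¹ * (y - x) := by
      apply mul_le_mul_of_nonneg_right _ (by linarith)
      apply mul_le_mul (hinv y t hy ht) (hinv x t (hxy.trans hy) ht)
      · apply inv_nonneg.2; linarith
      · positivity
    have h3 := hinv x y hxy (by linarith)
    have h4 : max 0 ((T - y)⁻¹ - (h + 1) / T) - max 0 ((T - x)⁻¹ - (h + 1) / T)
        ≤ (T - y)⁻¹ - (T - x)⁻¹ := by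
      rcases max_cases 0 ((T - y)⁻¹ - (h + 1) / T) with q | q <;>
      rcases max_cases 0 ((T - x)⁻¹ - (h + 1) / T) with q' | q' <;> linarith
    linarith
  · have h1 : Tendsto (fun t => T - t) (𝓝[<] T) (𝓝[>] 0) := by
      refine tendsto_nhdsWithin_iff.2 ⟨?_, ?_⟩
      · have : Tendsto (fun t => T - t) (𝓝 T) (𝓝 (T - T)) := by
          apply Continuous.tendsto; fun_prop
        rw [sub_self] at this
        exact this.mono_left nhdsWithin_le_nhds
      · filter_upwards [self_mem_nhdsWithin] with t ht
        exact sub_pos.2 (mem_Iio.1 ht)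
    have h2 : Tendsto (fun t => (T - t)⁻¹ + (-((h + 1) / T))) (𝓝[<] T) atTop :=
      tendsto_atTop_add_const_right _ _ (tendsto_inv_nhdsGT_zero.comp h1)
    refine tendsto_atTop_mono' _ ?_ h2
    filter_upwards [Ioo_mem_nhdsLT hT] with t ht
    have := hG ht.1.le
    have := le_max_right 0 ((T - t)⁻¹ - (h + 1) / T)
    linarith [ht.1]

/-- A sequence of good clocks converging pointwise. -/
lemma aux_seq {T : ℝ} (hT : 0 < T) (sig : ℝ → ℝ) (hsig0 : sig 0 = 0)
    (hexp : ∀ t1 ∈ Ico (0:ℝ) T, ∀ t2 ∈ Ico (0:ℝ) T, t1 < t2 → t2 - t1 < sig t2 - sig t1) :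
    ∃ f : ℕ → ℝ → ℝ, (∀ h, GoodClock T (f h)) ∧
      ∀ t ∈ Ico (0:ℝ) T, Tendsto (fun h => f h t) atTop (𝓝 (sig t)) := by
  set g : ℝ → ℝ := fun t => sig t - t with hgdef
  have hg : MonotoneOn g (Ico 0 T) := by
    intro x hx y hy hxy
    rcases hxy.eq_or_lt with rfl | hlt
    · exact le_rfl
    · have := hexp x hx y hy hlt
      simp only [hgdef]
      linarith
  set D : Set ℝ := ({0} ∪ (range ((↑) : ℚ → ℝ) ∩ Ico 0 T)) ∪
    {x ∈ Ico 0 T | ¬ContinuousWithinAt g (Ico 0 T) x} with hD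
  have hDc : D.Countable :=
    ((countable_singleton 0).union ((countable_range _).mono inter_subset_left)).union
      hg.countable_not_continuousWithinAt
  have h0D : (0:ℝ) ∈ D := Or.inl (Or.inl rfl)
  have hDsub : D ⊆ Ico 0 T := by
    rintro x ((hx | hx) | hx)
    · rw [mem_singleton_iff.1 hx]; exact ⟨le_rfl, hT⟩
    · exact hx.2
    · exact hx.1
  obtain ⟨u, hu⟩ := hDc.exists_eq_range ⟨0, h0D⟩
  have hF : ∀ h : ℕ, ∃ (G : ℝ → ℝ) (K : ℝ), 0 ≤ K ∧ Monotone G ∧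
      (∀ x y, x ≤ y → G y - G x ≤ K * (y - x)) ∧
      ∀ x ∈ insert 0 ((Finset.range h).image u), G x = g x := by
    intro h
    apply aux_interp _ (Finset.insert_nonempty _ _)
    apply hg.mono
    refine Subset.trans ?_ hDsub
    intro x hx
    simp only [Finset.coe_insert, Finset.coe_image, mem_insert_iff, mem_image] at hx
    rcases hx with rfl | ⟨n, -, rfl⟩
    · exact h0D
    · rw [hu]; exact mem_range_self n
  choose G K hK hGm hGL hGe using hF
  have hG0 : ∀ h, G h 0 = 0 := by
    intro h
    rw [hGe h 0 (Finset.mem_insert_self _ _)]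
    simp [hgdef, hsig0]
  have hGD : ∀ x ∈ D, ∀ᶠ h in atTop, G h x = g x := by
    intro x hx
    rw [hu] at hx
    obtain ⟨n, rfl⟩ := hx
    filter_upwards [eventually_gt_atTop n] with h hn
    apply hGe
    exact Finset.mem_insert_of_mem (Finset.mem_image_of_mem _ (Finset.mem_range.2 hn))
  have hGlim : ∀ t ∈ Ico (0:ℝ) T, Tendsto (fun h => G h t) atTop (𝓝 (g t)) := by
    intro t ht
    by_cases htD : t ∈ D
    · exact tendsto_const_nhds.congr' ((hGD t htD).mono fun h e => e.symm)
    · have hc : ContinuousWithinAt g (Ico 0 T) t := by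
        by_contra hc
        exact htD (Or.inr ⟨ht, hc⟩)
      have ht0 : 0 < t := lt_of_le_of_ne ht.1 (fun e => htD (e ▸ h0D))
      rw [Metric.tendsto_atTop']
      intro ε hε
      obtain ⟨δ, hδ, hd⟩ := Metric.continuousWithinAt_iff.1 hc ε hε
      obtain ⟨q, hq1, hq2⟩ := exists_rat_btwn (show max 0 (t - δ) < t from max_lt ht0 (by linarith))
      obtain ⟨r, hr1, hr2⟩ := exists_rat_btwn (show t < min T (t + δ) from lt_min ht.2 (by linarith))
      rw [max_lt_iff] at hq1
      rw [lt_min_iff] at hr2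
      have hqI : (q:ℝ) ∈ Ico 0 T := ⟨hq1.1.le, hq2.trans ht.2⟩
      have hrI : (r:ℝ) ∈ Ico 0 T := ⟨by linarith, hr2.1⟩
      have e1 := hGD q (Or.inl (Or.inr ⟨mem_range_self q, hqI⟩))
      have e2 := hGD r (Or.inl (Or.inr ⟨mem_range_self r, hrI⟩))
      have d1 := hd hqI (by rw [Real.dist_eq, abs_lt]; constructor <;> linarith)
      have d2 := hd hrI (by rw [Real.dist_eq, abs_lt]; constructor <;> linarith)
      rw [Real.dist_eq, abs_lt] at d1 d2
      obtain ⟨N, hN⟩ := eventually_atTop.1 (e1.and e2)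
      refine ⟨N, fun h hh => ?_⟩
      obtain ⟨a1, a2⟩ := hN h hh.le
      have m1 := hGm h hq2.le
      have m2 := hGm h hr1.le
      rw [Real.dist_eq, abs_lt]
      constructor <;> linarith [d1.1, d2.2]
  refine ⟨fun h t => t + G h t + max 0 ((T - t)⁻¹ - (h + 1) / T),
    fun h => aux_clock hT (G h) (K h) (hK h) (hG0 h) (hGm h) (hGL h) h, ?_⟩
  intro t ht
  have hl : Tendsto (fun h => t + G h t) atTop (𝓝 (sig t)) := by
    have := (hGlim t ht).const_add t
    simpa [hgdef] using this
  refine hl.congr' ?_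
  obtain ⟨N, hN⟩ := exists_nat_gt (T * (T - t)⁻¹)
  filter_upwards [eventually_ge_atTop N] with h hh
  have : (N:ℝ) ≤ h := by exact_mod_cast hh
  have h2 : (T - t)⁻¹ - (h + 1) / T ≤ 0 := by
    rw [sub_nonpos, le_div_iff₀ hT]
    linarith
  rw [max_eq_left h2, add_zero]

lemma aux_unif (p : ℕ → ℝ → ℝ) (q : ℝ → ℝ) (hp : ∀ h, LipschitzOnWith 1 (p h) (Ici 0))
    (hl : ∀ s ∈ Ici (0:ℝ), Tendsto (fun h => p h s) atTop (𝓝 (q s))) (A : ℝ) :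
    TendstoUniformlyOn p q atTop (Icc 0 A) := by
  have hpl : ∀ h, ∀ x ∈ Ici (0:ℝ), ∀ y ∈ Ici (0:ℝ), dist (p h x) (p h y) ≤ dist x y := by
    intro h x hx y hy
    simpa using (hp h).dist_le_mul x hx y hy
  have hql : ∀ x ∈ Ici (0:ℝ), ∀ y ∈ Ici (0:ℝ), dist (q x) (q y) ≤ dist x y := by
    intro x hx y hy
    exact le_of_tendsto ((hl x hx).dist (hl y hy)) (Eventually.of_forall fun h => hpl h x hx y hy)
  rw [Metric.tendstoUniformlyOn_iff]
  intro ε hε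
  have hε3 : 0 < ε / 3 := by linarith
  obtain ⟨N, hN⟩ := exists_nat_gt (A / (ε / 3))
  have ev : ∀ᶠ h in atTop, ∀ i ∈ Finset.range (N + 1),
      dist (p h (i * (ε / 3))) (q (i * (ε / 3))) < ε / 3 := by
    rw [Filter.eventually_all_finset]
    intro i _
    exact Metric.tendsto_nhds.1 (hl (i * (ε / 3)) (mem_Ici.2 (by positivity))) _ hε3
  filter_upwards [ev] with h hh s hs
  have hs0 : 0 ≤ s / (ε / 3) := div_nonneg hs.1 hε3.le
  set i := ⌊s / (ε / 3)⌋₊ with hi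
  have f1 := Nat.floor_le hs0
  have f2 := Nat.lt_floor_add_one (s / (ε / 3))
  rw [← hi] at f1 f2
  have iN : i < N + 1 := by
    have : s / (ε / 3) ≤ A / (ε / 3) := div_le_div_of_nonneg_right hs.2 hε3.le
    have : (i:ℝ) < N := by linarith
    have : i < N := by exact_mod_cast this
    omega
  rw [le_div_iff₀ hε3] at f1
  rw [div_lt_iff₀ hε3] at f2
  have c := hh i (Finset.mem_range.2 iN)
  have hx : (i * (ε / 3) : ℝ) ∈ Ici (0:ℝ) := mem_Ici.2 (by positivity)
  have dd : dist s (i * (ε / 3)) ≤ ε / 3 := by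
    rw [Real.dist_eq, abs_of_nonneg (by linarith)]
    linarith
  have a := hql s hs.1 _ hx
  have b := hpl h s hs.1 _ hx
  have t1 := dist_triangle (q s) (q (i * (ε / 3))) (p h s)
  have t2 := dist_triangle (q (i * (ε / 3))) (p h (i * (ε / 3))) (p h s)
  rw [dist_comm (q (i * (ε / 3)))  (p h (i * (ε / 3))), dist_comm (p h (i * (ε / 3))) (p h s)] at t2
  linarith

/-- Theorem 5.2, Case 2 (`S̄ = +∞`): approximation of an expansive, strictly increasing,
diverging clock `σ` by absolutely continuous, strictly increasing, surjective clocks `σₕ`,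
with the stated properties of the inverses `φ₀ₕ`. -/
theorem stmt6 (T : ℝ) (hT : 0 < T)
    (sig : ℝ → ℝ) (hsig0 : sig 0 = 0)
    (hexp : ∀ t1 ∈ Ico (0:ℝ) T, ∀ t2 ∈ Ico (0:ℝ) T, t1 < t2 → t2 - t1 < sig t2 - sig t1)
    (hdiv : Tendsto sig (𝓝[<] T) atTop)
    (phi0 : ℝ → ℝ) (hphi0mono : MonotoneOn phi0 (Ici 0))
    (hphi0surj : phi0 '' Ici 0 = Ico 0 T)
    (hphi0inv : ∀ t ∈ Ico (0:ℝ) T, phi0 (sig t) = t) :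
    ∃ (sigh : ℕ → ℝ → ℝ) (phi0h : ℕ → ℝ → ℝ),
      -- σₕ(0)=0, σₕ strictly increasing and absolutely continuous on [0,t] for all t<T
      (∀ h, sigh h 0 = 0) ∧
      (∀ h, StrictMonoOn (sigh h) (Ico 0 T)) ∧
      (∀ h, ∀ t ∈ Ico (0:ℝ) T, ACOnI (sigh h) 0 t) ∧
      -- lim_{t→T} σₕ(t) = +∞
      (∀ h, Tendsto (sigh h) (𝓝[<] T) atTop) ∧
      -- pointwise convergence σₕ → σ on [0,T)
      (∀ t ∈ Ico (0:ℝ) T, Tendsto (fun h => sigh h t) atTop (𝓝 (sig t))) ∧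
      -- φ₀ₕ = σₕ⁻¹ : ℝ₊ → [0,T) strictly increasing, 1-Lipschitz, surjective
      (∀ h, StrictMonoOn (phi0h h) (Ici 0)) ∧
      (∀ h, LipschitzOnWith 1 (phi0h h) (Ici 0)) ∧
      (∀ h, phi0h h '' Ici 0 = Ico 0 T) ∧
      (∀ h, ∀ t ∈ Ico (0:ℝ) T, phi0h h (sigh h t) = t) ∧
      (∀ h, ∀ s ∈ Ici (0:ℝ), sigh h (phi0h h s) = s) ∧
      -- locally uniform convergence φ₀ₕ → φ₀
      (∀ A : ℝ, TendstoUniformlyOn (fun h => phi0h h) phi0 atTop (Icc 0 A)) ∧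
      -- for every S > 0, with t := φ₀(S) and tₕ := φ₀ₕ(S):
      (∀ S > (0:ℝ), ∃ epsS : ℕ → ℝ,
        (∀ h, ∀ s ∈ Icc (0:ℝ) S, |phi0h h s - phi0 s| ≤ epsS h) ∧
        Tendsto epsS atTop (𝓝 0) ∧
        phi0 S < T ∧
        (∀ h, phi0h h S < T) ∧
        (∀ h, |phi0h h S - phi0 S| ≤ epsS h) ∧
        (∀ h, ∀ s ∈ Ici (0:ℝ),
          |phi0h h s - phi0 s| ≤ epsS h + (T - min (phi0 S) (phi0h h S)))) := by
  have hq : ∀ s ∈ Ici (0:ℝ), phi0 s ∈ Ico 0 T := by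
    intro s hs
    rw [← hphi0surj]
    exact mem_image_of_mem _ hs
  obtain ⟨f, hf, hlim⟩ := aux_seq hT sig hsig0 hexp
  choose p hpm hpl hpi hp1 hp2 using fun h => (hf h).inv hT
  have hpI : ∀ h, ∀ s ∈ Ici (0:ℝ), p h s ∈ Ico 0 T := by
    intro h s hs
    rw [← hpi h]
    exact mem_image_of_mem _ hs
  have hsnn : ∀ t ∈ Ico (0:ℝ) T, sig t ∈ Ici (0:ℝ) := by
    intro t ht
    rcases ht.1.eq_or_lt with h | h
    · rw [← h, hsig0]; exact mem_Ici.2 le_rfl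
    · have := hexp 0 ⟨le_rfl, hT⟩ t ht h
      rw [hsig0] at this
      exact mem_Ici.2 (by linarith)
  have hpt : ∀ s ∈ Ici (0:ℝ), Tendsto (fun h => p h s) atTop (𝓝 (phi0 s)) := by
    intro s hs
    refine tendsto_order.2 ⟨fun a ha => ?_, fun b hb => ?_⟩
    · rcases lt_or_ge a 0 with h0 | h0
      · exact Eventually.of_forall fun h => h0.trans_le (hpI h s hs).1
      have haI : a ∈ Ico 0 T := ⟨h0, ha.trans (hq s hs).2⟩
      have h1 : sig a < s := by
        by_contra hc
        have := hphi0mono hs (hsnn a haI) (not_lt.1 hc)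
        rw [hphi0inv a haI] at this
        linarith
      filter_upwards [(hlim a haI).eventually_lt_const h1] with h hh
      rw [← (hf h).strictMono.lt_iff_lt haI (hpI h s hs), hp2 h s hs]
      exact hh
    · rcases le_or_gt T b with h0 | h0
      · exact Eventually.of_forall fun h => (hpI h s hs).2.trans_le h0
      have hbI : b ∈ Ico 0 T := ⟨((hq s hs).1.trans_lt hb).le, h0⟩
      have h1 : s < sig b := by
        by_contra hc
        have := hphi0mono (hsnn b hbI) hs (not_lt.1 hc)
        rw [hphi0inv b hbI] at this
        linarith
      filter_upwards [(hlim b hbI).eventually_const_lt h1] with h hh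
      rw [← (hf h).strictMono.lt_iff_lt (hpI h s hs) hbI, hp2 h s hs]
      exact hh
  have hunif := aux_unif p phi0 hpl hpt
  refine ⟨f, p, fun h => (hf h).zero, fun h => (hf h).strictMono, fun h t ht => (hf h).ac ht,
    fun h => (hf h).lim, hlim, hpm, hpl, hpi, hp1, hp2, hunif, ?_⟩
  intro S hS
  have hSm : S ∈ Ici (0:ℝ) := hS.le
  have hbd : ∀ h, BddAbove ((fun s => |p h s - phi0 s|) '' Icc 0 S) := by
    intro h
    refine ⟨T, ?_⟩
    rintro _ ⟨s, hs, rfl⟩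
    have h1 := hpI h s hs.1
    have h2 := hq s hs.1
    exact abs_le.2 ⟨by linarith [h1.1, h2.2], by linarith [h1.2, h2.1]⟩
  have hle : ∀ h, ∀ s ∈ Icc (0:ℝ) S,
      |p h s - phi0 s| ≤ sSup ((fun s => |p h s - phi0 s|) '' Icc 0 S) :=
    fun h s hs => le_csSup (hbd h) (mem_image_of_mem _ hs)
  have hSS : S ∈ Icc (0:ℝ) S := ⟨hS.le, le_rfl⟩
  have hnn : ∀ h, 0 ≤ sSup ((fun s => |p h s - phi0 s|) '' Icc 0 S) :=
    fun h => (abs_nonneg _).trans (hle h S hSS)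
  refine ⟨fun h => sSup ((fun s => |p h s - phi0 s|) '' Icc 0 S), hle, ?_, (hq S hSm).2,
    fun h => (hpI h S hSm).2, fun h => hle h S hSS, ?_⟩
  · rw [Metric.tendsto_nhds]
    intro ε hε
    filter_upwards [Metric.tendstoUniformlyOn_iff.1 (hunif S) (ε / 2) (by linarith)] with h hh
    rw [Real.dist_eq, sub_zero, abs_of_nonneg (hnn h)]
    refine lt_of_le_of_lt (csSup_le ⟨_, mem_image_of_mem _ hSS⟩ ?_) (half_lt_self hε)
    rintro _ ⟨s, hs, rfl⟩
    have := (hh s hs).le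
    rwa [dist_comm, Real.dist_eq] at this
  · intro h s hs
    rcases le_total s S with hsS | hsS
    · have h1 := hle h s ⟨hs, hsS⟩
      have h2 := min_le_left (phi0 S) (p h S)
      have h3 := (hq S hSm).2
      simp only
      linarith
    · have h1 := hphi0mono hSm hs hsS
      have h2 := (hpm h).monotoneOn hSm hs hsS
      have h3 := min_le_left (phi0 S) (p h S)
      have h4 := min_le_right (phi0 S) (p h S)
      have h5 := hnn h
      have h6 := (hq s hs).2
      have h7 := (hpI h s hs).2
      simp only
      exact abs_le.2 ⟨by linarith, by linarith⟩

end
end
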